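/- arXiv:1010.2220 — 12 statements merged into one kernel-verified Lean document; each statement's English description precedes it below -/
import Mathlib

section
/- Let (X,T) be a topological dynamical system. Then (X,T) is topologically deterministic if and only if every closed equivalence relation R ⊆ X × X that is forward invariant under T×T (i.e. (T×T)(R) ⊆ R) is in fact invariant (i.e. (T×T)(R) = R). -/
open Filter Topology

/-- A factor map between topological dynamical systems: a continuous surjection
intertwining the dynamics. -/
def IsFactorMap {X Y : Type} [TopologicalSpace X] [TopologicalSpace Y]
    (T : X → X) (S : Y → Y) (π : X → Y) : Prop :=
  Continuous π ∧ Function.Surjective π ∧ S ∘ π = π ∘ T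

/-- A topological dynamical system `(X,T)` (with `X` compact metric, `T` a continuous
surjection) is topologically deterministic if for every topological dynamical system
`(Y,S)` admitting a factor map from `(X,T)`, the map `S` is injective. -/
def TopDeterministic (X : Type) [MetricSpace X] [CompactSpace X] (T : X → X) : Prop :=
  ∀ (Y : Type) [MetricSpace Y] [CompactSpace Y] (S : Y → Y),
    Continuous S → Function.Surjective S →
    (∃ π : X → Y, IsFactorMap T S π) → Function.Injective S

/-- A point `x` is forward recurrent for `f` if there is a sequence `n k → ∞`
with `f^[n k] x → x`. -/
def ForwardRecurrent {X : Type} [TopologicalSpace X] (f : X → X) (x : X) : Prop :=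
  ∃ n : ℕ → ℕ, Tendsto n atTop atTop ∧ Tendsto (fun k => f^[n k] x) atTop (nhds x)

/-- `(X,T)` is pointwise rigid if there is a single sequence `n k → ∞` with
`T^[n k] x → x` for every `x`. -/
def PointwiseRigid {X : Type} [TopologicalSpace X] (T : X → X) : Prop :=
  ∃ n : ℕ → ℕ, Tendsto n atTop atTop ∧ ∀ x, Tendsto (fun k => T^[n k] x) atTop (nhds x)

/-- The ω-limit set of `y` under `f`: `⋂_{n ≥ 1} closure {f^[k] y : k ≥ n}`. -/
def omegaSet {X : Type} [TopologicalSpace X] (f : X → X) (y : X) : Set X :=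
  ⋂ n ∈ Set.Ici 1, closure ((fun k => f^[k] y) '' Set.Ici n)

/-- A Hausdorff criterion for images of normal spaces under closed maps. -/
theorem IsClosedMap.t2Space_of_surjective {X Y : Type*} [TopologicalSpace X] [NormalSpace X]
    [T1Space X] [TopologicalSpace Y] {f : X → Y} (hf : IsClosedMap f) (hc : Continuous f)
    (hs : Function.Surjective f) : T2Space Y := by
  have hpt (y : Y) : IsClosed ({y} : Set Y) := by
    obtain ⟨x, rfl⟩ := hs y
    simpa using hf {x} isClosed_singleton
  refine ⟨fun y z hyz => ?_⟩
  obtain ⟨U, V, hU, hV, hyU, hzV, hUV⟩ := normal_separation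
    ((hpt y).preimage hc) ((hpt z).preimage hc)
    (Disjoint.preimage f (Set.disjoint_singleton.2 hyz))
  refine ⟨Set.kernImage f U, Set.kernImage f V, isClosedMap_iff_kernImage.1 hf hU,
    isClosedMap_iff_kernImage.1 hf hV, fun x hx => hyU hx, fun x hx => hzV hx, ?_⟩
  rw [Set.disjoint_left]
  intro w hwU hwV
  obtain ⟨x, rfl⟩ := hs w
  exact Set.disjoint_left.1 hUV (hwU rfl) (hwV rfl)

/-- The image of a second countable space under a continuous closed surjection with compact
fibres is second countable. -/
theorem IsClosedMap.secondCountableTopology_of_surjective {X Y : Type*} [TopologicalSpace X]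
    [SecondCountableTopology X] [TopologicalSpace Y] {f : X → Y} (hf : IsClosedMap f)
    (hc : Continuous f) (hs : Function.Surjective f) (hk : ∀ y, IsCompact (f ⁻¹' {y})) :
    SecondCountableTopology Y := by
  have hB := TopologicalSpace.isBasis_countableBasis X
  set B := TopologicalSpace.countableBasis X
  refine (TopologicalSpace.isTopologicalBasis_of_isOpen_of_nhds
    (s := (fun F => Set.kernImage f (⋃₀ F)) '' {F : Set (Set X) | F.Finite ∧ F ⊆ B})
    ?_ ?_).secondCountableTopology
      ((Set.countable_ofPred_finite_subset
        (TopologicalSpace.countable_countableBasis X)).image _)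
  · rintro _ ⟨F, ⟨-, hF⟩, rfl⟩
    exact isClosedMap_iff_kernImage.1 hf (isOpen_sUnion fun t ht => hB.isOpen (hF ht))
  · intro y V hy hV
    have hcover : ∃ F : Set (Set X), F.Finite ∧ F ⊆ B ∧ f ⁻¹' {y} ⊆ ⋃₀ F ∧ ⋃₀ F ⊆ f ⁻¹' V := by
      refine (hk y).induction_on (p := fun s => ∃ F : Set (Set X), F.Finite ∧ F ⊆ B ∧
        s ⊆ ⋃₀ F ∧ ⋃₀ F ⊆ f ⁻¹' V) ⟨∅, by simp⟩ ?_ ?_ ?_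
      · rintro s t hst ⟨F, h1, h2, h3, h4⟩
        exact ⟨F, h1, h2, hst.trans h3, h4⟩
      · rintro s t ⟨F, h1, h2, h3, h4⟩ ⟨G, g1, g2, g3, g4⟩
        refine ⟨F ∪ G, h1.union g1, Set.union_subset h2 g2, ?_, ?_⟩
        · rw [Set.sUnion_union]
          exact Set.union_subset_union h3 g3
        · rw [Set.sUnion_union]
          exact Set.union_subset h4 g4
      · intro x hx
        have hxV : x ∈ f ⁻¹' V := by
          rw [Set.mem_preimage, show f x = y from hx]
          exact hy
        obtain ⟨t, htB, hxt, htV⟩ := hB.exists_subset_of_mem_open hxV (hV.preimage hc)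
        exact ⟨t, mem_nhdsWithin_of_mem_nhds ((hB.isOpen htB).mem_nhds hxt), {t},
          Set.finite_singleton t, by simpa using htB, by simp, by simpa using htV⟩
    obtain ⟨F, h1, h2, h3, h4⟩ := hcover
    refine ⟨_, ⟨F, ⟨h1, h2⟩, rfl⟩, fun x hx => h3 hx, fun w hw => ?_⟩
    obtain ⟨x, rfl⟩ := hs w
    exact h4 (hw rfl)

/-- The quotient map of a compact space by a closed equivalence relation is closed. -/
theorem Setoid.isClosedMap_mk_of_isClosed {X : Type*} [TopologicalSpace X] [CompactSpace X]
    (s : Setoid X) (hs : IsClosed {p : X × X | s p.1 p.2}) :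
    IsClosedMap (Quotient.mk s) := by
  intro C hC
  rw [← isQuotientMap_quotient_mk'.isClosed_preimage]
  convert isClosedMap_snd_of_compactSpace _ (hs.inter (hC.preimage continuous_fst)) using 1
  ext y
  constructor
  · rintro ⟨x, hx, hxy⟩
    exact ⟨(x, y), ⟨Quotient.exact hxy, hx⟩, rfl⟩
  · rintro ⟨⟨x, z⟩, ⟨hxz, hx⟩, rfl⟩
    exact ⟨x, hx, Quotient.sound hxz⟩

/-- The quotient of a compact metrizable space by a closed equivalence relation is metrizable. -/
theorem Setoid.metrizableSpace_quotient {X : Type*} [TopologicalSpace X] [CompactSpace X]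
    [TopologicalSpace.MetrizableSpace X] (s : Setoid X)
    (hs : IsClosed {p : X × X | s p.1 p.2}) :
    TopologicalSpace.MetrizableSpace (Quotient s) := by
  let := TopologicalSpace.metrizableSpaceMetric X
  have hf := s.isClosedMap_mk_of_isClosed hs
  have hc : Continuous (Quotient.mk s) := continuous_quot_mk
  have hsurj : Function.Surjective (Quotient.mk s) := Quotient.mk_surjective
  have : T2Space (Quotient s) := hf.t2Space_of_surjective hc hsurj
  have : SecondCountableTopology (Quotient s) :=
    hf.secondCountableTopology_of_surjective hc hsurj
      fun y => (isClosed_singleton.preimage hc).isCompact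
  infer_instance

/-- `(X,T)` is topologically deterministic iff every closed equivalence
relation `R ⊆ X × X` that is forward invariant under `T×T` is in fact invariant. -/
theorem stmt0 {X : Type} [MetricSpace X] [CompactSpace X] (T : X → X)
    (hT : Continuous T) (hTsurj : Function.Surjective T) :
    TopDeterministic X T ↔
      ∀ R : Set (X × X), IsClosed R →
        (∀ x : X, (x, x) ∈ R) →
        (∀ x y : X, (x, y) ∈ R → (y, x) ∈ R) →
        (∀ x y z : X, (x, y) ∈ R → (y, z) ∈ R → (x, z) ∈ R) →
        Prod.map T T '' R ⊆ R → Prod.map T T '' R = R := by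
  constructor
  · intro hTD R hR hrefl hsymm htrans hfwd
    let s : Setoid X := ⟨fun x y => (x, y) ∈ R, hrefl, @hsymm, @htrans⟩
    have := s.metrizableSpace_quotient hR
    let := TopologicalSpace.metrizableSpaceMetric (Quotient s)
    have hmap : ∀ x y, s x y → s (T x) (T y) := fun x y h => hfwd ⟨(x, y), h, rfl⟩
    have hinj := hTD (Quotient s) (Quotient.map T hmap)
      (hT.quotient_map' hmap)
      (fun q => by
        obtain ⟨y, rfl⟩ := Quotient.mk_surjective q
        obtain ⟨x, rfl⟩ := hTsurj y
        exact ⟨Quotient.mk s x, rfl⟩)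
      ⟨Quotient.mk s, continuous_quot_mk, Quotient.mk_surjective, rfl⟩
    refine hfwd.antisymm ?_
    rintro ⟨a, b⟩ hab
    obtain ⟨x, rfl⟩ := hTsurj a
    obtain ⟨y, rfl⟩ := hTsurj b
    refine ⟨(x, y), ?_, rfl⟩
    have hq : Quotient.mk s x = Quotient.mk s y :=
      hinj (show Quotient.mk s (T x) = Quotient.mk s (T y) from Quotient.sound hab)
    exact Quotient.exact hq
  · rintro h Y _ _ S - - ⟨π, hπ, hπs, hcomm⟩ y z hyz
    have hST : ∀ x, π (T x) = S (π x) := fun x => (congrFun hcomm x).symm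
    let R : Set (X × X) := {p | π p.1 = π p.2 ∨
      ((π p.1 = y ∨ π p.1 = z) ∧ (π p.2 = y ∨ π p.2 = z))}
    have hpre (w : Y) {f : X × X → X} (hf : Continuous f) : IsClosed {p | π (f p) = w} :=
      isClosed_eq (hπ.comp hf) continuous_const
    have hclosed : IsClosed R :=
      (isClosed_eq (hπ.comp continuous_fst) (hπ.comp continuous_snd)).union
        (((hpre y continuous_fst).union (hpre z continuous_fst)).inter
          ((hpre y continuous_snd).union (hpre z continuous_snd)))
    have hcollapse : ∀ a b, (a, b) ∈ R → π (T a) = π (T b) := by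
      intro a b hab
      rw [hST, hST]
      rcases hab with hab | ⟨ha | ha, hb | hb⟩ <;> simp_all
    have hinv := h R hclosed (fun x => Or.inl rfl)
      (fun a b hab => hab.imp Eq.symm And.symm)
      (by
        rintro a b c (hab | ⟨ha, hb⟩) (hbc | ⟨hb', hc⟩)
        · exact Or.inl (hab.trans hbc)
        · exact Or.inr ⟨by simp only at hab hb' ⊢; rwa [hab], hc⟩
        · exact Or.inr ⟨ha, by simp only at hbc hb ⊢; rwa [← hbc]⟩
        · exact Or.inr ⟨ha, hc⟩)
      (by
        rintro _ ⟨⟨a, b⟩, hab, rfl⟩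
        exact Or.inl (hcollapse a b hab))
    obtain ⟨a, rfl⟩ := hπs y
    obtain ⟨b, rfl⟩ := hπs z
    have hab : (a, b) ∈ R := Or.inr ⟨Or.inl rfl, Or.inr rfl⟩
    rw [← hinv] at hab
    obtain ⟨⟨u, v⟩, huv, he⟩ := hab
    obtain ⟨rfl, rfl⟩ := Prod.mk.inj he
    exact hcollapse u v huv
end

section
/- Let (X,T) be a topological dynamical system. If every point of X × X is forward recurrent for the map T×T, then (X,T) is topologically deterministic. -/
open Filter Topology

/-- if every point of `X × X` is forward recurrent for `T×T`,
then `(X,T)` is topologically deterministic. -/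
theorem stmt1 {X : Type} [MetricSpace X] [CompactSpace X] (T : X → X)
    (hT : Continuous T) (hTsurj : Function.Surjective T)
    (hrec : ∀ p : X × X, ForwardRecurrent (Prod.map T T) p) :
    TopDeterministic X T := by
  intro Y _ _ S _ _ ⟨π, hπ, hsurj, hcomm⟩ y₁ y₂ h
  obtain ⟨x₁, rfl⟩ := hsurj y₁
  obtain ⟨x₂, rfl⟩ := hsurj y₂
  obtain ⟨n, hn, hlim⟩ := hrec (x₁, x₂)
  have hiter (m : ℕ) (x : X) : π (T^[m] x) = S^[m] (π x) :=
    Function.Semiconj.iterate_right (f := π) (fun z => (congrFun hcomm z).symm) m x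
  simp only [Prod.map_iterate, Prod.map_apply] at hlim
  have h₁ : Tendsto (fun k => S^[n k] (π x₁)) atTop (𝓝 (π x₁)) := by
    simpa only [Function.comp_def, hiter] using (hπ.tendsto x₁).comp hlim.fst_nhds
  have h₂ : Tendsto (fun k => S^[n k] (π x₂)) atTop (𝓝 (π x₂)) := by
    simpa only [Function.comp_def, hiter] using (hπ.tendsto x₂).comp hlim.snd_nhds
  refine tendsto_nhds_unique_of_eventuallyEq h₁ h₂ ?_
  filter_upwards [hn.eventually_ge_atTop 1] with k hk
  obtain ⟨m, hm⟩ := Nat.exists_eq_succ_of_ne_zero (Nat.one_le_iff_ne_zero.mp hk)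
  rw [hm, Function.iterate_succ_apply, Function.iterate_succ_apply, h]
end

section
/- Let (X,T) be a topological dynamical system. If (X,T) is topologically deterministic, then every point of X is forward recurrent for T. -/
open Filter Topology

/-- Collapsing a nonempty closed subset of a compact metric space to a point yields a compact
metric space. -/
theorem exists_collapse {X : Type} [MetricSpace X] [CompactSpace X] {A : Set X}
    (hA : IsClosed A) (hne : A.Nonempty) :
    ∃ (Y : Type) (_ : MetricSpace Y) (_ : CompactSpace Y) (π : X → Y),
      Continuous π ∧ Function.Surjective π ∧
        ∀ y z, π y = π z ↔ y = z ∨ (y ∈ A ∧ z ∈ A) := by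
  let F : C(X, C(X, ℝ)) := ContinuousMap.curry
    ⟨fun p : X × X => Metric.infDist p.1 A * dist p.1 p.2,
      ((Metric.continuous_infDist_pt A).comp continuous_fst).mul continuous_dist⟩
  let φ : X → ℝ × C(X, ℝ) := fun y => (Metric.infDist y A, F y)
  have hφ : Continuous φ := (Metric.continuous_infDist_pt A).prodMk F.continuous
  refine ⟨Set.range φ, inferInstance, isCompact_iff_compactSpace.1 (isCompact_range hφ),
    Set.rangeFactorization φ, hφ.subtype_mk _, Set.rangeFactorization_surjective, ?_⟩
  have hF (y z : X) : F y z = Metric.infDist y A * dist y z := rfl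
  intro y z
  rw [Subtype.ext_iff, Set.rangeFactorization_coe, Set.rangeFactorization_coe, Prod.mk.injEq]
  simp only [hA.mem_iff_infDist_zero hne]
  constructor
  · rintro ⟨h₁, h₂⟩
    have h₃ := DFunLike.congr_fun h₂ z
    rw [hF, hF, dist_self, mul_zero, mul_eq_zero, dist_eq_zero] at h₃
    rcases h₃ with h | h
    · exact Or.inr ⟨h, h₁ ▸ h⟩
    · exact Or.inl h
  · rintro (rfl | ⟨hy, hz⟩)
    · exact ⟨rfl, rfl⟩
    · refine ⟨hy.trans hz.symm, ContinuousMap.ext fun w => ?_⟩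
      rw [hF, hF, hy, hz, zero_mul, zero_mul]

/-- In a topologically deterministic system, a nonempty closed forward invariant set contains
every point whose image it contains. -/
theorem TopDeterministic.mem_of_apply_mem {X : Type} [MetricSpace X] [CompactSpace X] {T : X → X}
    (hdet : TopDeterministic X T) (hT : Continuous T) (hTsurj : Function.Surjective T)
    {A : Set X} (hA : IsClosed A) (hne : A.Nonempty) (hinv : Set.MapsTo T A A) {x : X}
    (hx : T x ∈ A) : x ∈ A := by
  obtain ⟨Y, _, _, π, hπ, hπs, hker⟩ := exists_collapse hA hne
  have hσ := Function.surjInv_eq hπs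
  set σ := Function.surjInv hπs
  have hcomm (y : X) : π (T (σ (π y))) = π (T y) := by
    rw [hker]
    rcases (hker _ _).1 (hσ (π y)) with h | ⟨h₁, h₂⟩
    · exact Or.inl (congrArg T h)
    · exact Or.inr ⟨hinv h₁, hinv h₂⟩
  let S : Y → Y := fun q => π (T (σ q))
  have hSπ : S ∘ π = π ∘ T := funext hcomm
  have hS : Continuous S := by
    rw [(hπ.isClosedMap.isQuotientMap hπ hπs).continuous_iff, hSπ]
    exact hπ.comp hT
  have hSs : Function.Surjective S := by
    refine Function.Surjective.of_comp (g := π) ?_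
    rw [hSπ]
    exact hπs.comp hTsurj
  have hinj := hdet Y S hS hSs ⟨π, hπ, hπs, hSπ⟩
  obtain ⟨a, ha⟩ := hne
  have hxa : π x = π a := hinj <| by
    change (S ∘ π) x = (S ∘ π) a
    rw [hSπ]
    exact (hker _ _).2 (Or.inr ⟨hx, hinv ha⟩)
  rcases (hker _ _).1 hxa with rfl | h
  · exact ha
  · exact h.1

/-- The closure of a tail of an orbit is forward invariant. -/
theorem mapsTo_closure_orbit_tail {X : Type*} [TopologicalSpace X] {T : X → X}
    (hT : Continuous T) (x : X) (N : ℕ) :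
    Set.MapsTo T (closure ((fun k => T^[k] x) '' Set.Ici N))
      (closure ((fun k => T^[k] x) '' Set.Ici N)) := by
  refine Set.MapsTo.closure ?_ hT
  rintro _ ⟨k, hk, rfl⟩
  exact ⟨k + 1, Nat.le_succ_of_le hk, Function.iterate_succ_apply' T k x⟩

/-- if `(X,T)` is topologically deterministic, then every point of `X`
is forward recurrent for `T`. -/
theorem stmt2 {X : Type} [MetricSpace X] [CompactSpace X] (T : X → X)
    (hT : Continuous T) (hTsurj : Function.Surjective T)
    (hdet : TopDeterministic X T) :
    ∀ x : X, ForwardRecurrent T x := by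
  intro x
  have hmem (N : ℕ) : x ∈ closure ((fun k => T^[k] x) '' Set.Ici N) := by
    induction N with
    | zero => exact subset_closure ⟨0, Set.mem_Ici.2 le_rfl, rfl⟩
    | succ N ih =>
      have hinv := mapsTo_closure_orbit_tail hT x (N + 1)
      refine hdet.mem_of_apply_mem hT hTsurj isClosed_closure
        (Set.nonempty_Ici.image _).closure hinv ?_
      refine Set.MapsTo.closure ?_ hT ih
      rintro _ ⟨k, hk, rfl⟩
      exact ⟨k + 1, Nat.succ_le_succ hk, Function.iterate_succ_apply' T k x⟩
  have hcl : MapClusterPt x atTop (fun k => T^[k] x) := by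
    rw [mapClusterPt_iff_frequently]
    intro U hU
    rw [frequently_atTop]
    intro N
    obtain ⟨_, hU', k, hk, rfl⟩ := mem_closure_iff_nhds.1 (hmem N) U hU
    exact ⟨k, hk, hU'⟩
  obtain ⟨n, hn, hlim⟩ := hcl.tendsto_subseq
  exact ⟨n, hn.tendsto_atTop, hlim⟩
end

section
/- Let (X,T) be a topological dynamical system and x ∈ X. If x is forward recurrent for T, then x is forward recurrent for T^n for every n ≥ 1. -/
open Filter Topology

/-- The filter on times `m : ℕ` along which `m → ∞` and `f^[m] x → x`. -/
def returnFilter {X : Type} [TopologicalSpace X] (f : X → X) (x : X) : Filter ℕ :=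
  atTop ⊓ comap (fun m => f^[m] x) (𝓝 x)

theorem tendsto_returnFilter_iff {X ι : Type} [TopologicalSpace X] {f : X → X} {x : X}
    {l : Filter ι} {u : ι → ℕ} :
    Tendsto u l (returnFilter f x) ↔
      Tendsto u l atTop ∧ Tendsto (fun i => f^[u i] x) l (𝓝 x) := by
  rw [returnFilter, tendsto_inf, tendsto_comap_iff]
  rfl

theorem eventually_returnFilter_add {X : Type} [TopologicalSpace X] {f : X → X}
    (hf : Continuous f) {x : X} {p : ℕ → Prop} (hp : ∀ᶠ m in returnFilter f x, p m) :
    ∀ᶠ a in returnFilter f x, ∀ᶠ b in returnFilter f x, p (a + b) := by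
  obtain ⟨s, hs, t, ht, hst⟩ := mem_inf_iff_superset.1 hp
  obtain ⟨N, hN⟩ := mem_atTop_sets.1 hs
  obtain ⟨V, hV, hVt⟩ := mem_comap.1 ht
  obtain ⟨U, hUV, hU, hxU⟩ := mem_nhds_iff.1 hV
  have htends := tendsto_returnFilter_iff.1 (tendsto_id (x := returnFilter f x))
  filter_upwards [htends.1.eventually_ge_atTop N, htends.2.eventually_mem (hU.mem_nhds hxU)]
    with a haN haU
  have hlim : Tendsto (fun b => f^[a] (f^[b] x)) (returnFilter f x) (𝓝 (f^[a] x)) :=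
    ((hf.iterate a).tendsto x).comp htends.2
  filter_upwards [hlim.eventually_mem (hU.mem_nhds haU)] with b hb
  refine hst ⟨hN _ (le_add_right haN), hVt (hUV ?_)⟩
  simpa only [Function.iterate_add_apply] using hb

theorem frequently_returnFilter_cast_add {X : Type} [TopologicalSpace X] {f : X → X}
    (hf : Continuous f) {x : X} {R : Type} [AddMonoidWithOne R] {c d : R}
    (hc : ∃ᶠ m in returnFilter f x, ((m : ℕ) : R) = c)
    (hd : ∃ᶠ m in returnFilter f x, ((m : ℕ) : R) = d) :
    ∃ᶠ m in returnFilter f x, ((m : ℕ) : R) = c + d := by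
  intro h
  obtain ⟨a, ha, hab⟩ := (hc.and_eventually (eventually_returnFilter_add hf h)).exists
  obtain ⟨b, hb, hne⟩ := (hd.and_eventually hab).exists
  exact hne (by simp only [Nat.cast_add, ha, hb])

theorem frequently_returnFilter_dvd {X : Type} [TopologicalSpace X] {f : X → X}
    (hf : Continuous f) {x : X} [(returnFilter f x).NeBot] (n : ℕ) [NeZero n] :
    ∃ᶠ m in returnFilter f x, n ∣ m := by
  obtain ⟨c, hc⟩ : ∃ c : ZMod n, ∃ᶠ m in returnFilter f x, ((m : ℕ) : ZMod n) = c := by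
    by_contra! h
    obtain ⟨m, hm⟩ := (eventually_all.2 h).exists
    exact hm m rfl
  have hmul (k : ℕ) :
      ∃ᶠ m in returnFilter f x, ((m : ℕ) : ZMod n) = (k + 1) • c := by
    induction k with
    | zero => simpa using hc
    | succ k ih => simpa only [succ_nsmul _ (k + 1)] using frequently_returnFilter_cast_add hf ih hc
  have hzero := hmul (n - 1)
  rw [Nat.sub_add_cancel (NeZero.one_le : 1 ≤ n)] at hzero
  simpa [ZMod.natCast_eq_zero_iff] using hzero

/-- if `x` is forward recurrent for `T` then `x` is forward recurrent
for `T^n` for every `n ≥ 1`. -/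
theorem stmt3 {X : Type} [MetricSpace X] [CompactSpace X] (T : X → X)
    (hT : Continuous T) (hTsurj : Function.Surjective T) (x : X)
    (hx : ForwardRecurrent T x) :
    ∀ n : ℕ, 1 ≤ n → ForwardRecurrent T^[n] x := by
  intro n hn
  obtain ⟨u, hu⟩ := hx
  have : (returnFilter T x).NeBot := (tendsto_returnFilter_iff.2 hu).neBot
  have : NeZero n := ⟨by lia⟩
  have : (returnFilter T x).IsCountablyGenerated := by
    unfold returnFilter
    infer_instance
  obtain ⟨v, hv, hdvd⟩ := exists_seq_forall_of_frequently (frequently_returnFilter_dvd hT (x := x) n)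
  choose w hw using hdvd
  obtain rfl : v = fun k => n * w k := funext hw
  obtain ⟨hv_top, hv_lim⟩ := tendsto_returnFilter_iff.1 hv
  refine ⟨w, ?_, by simpa only [Function.iterate_mul] using hv_lim⟩
  exact hv_top.atTop_of_const_mul₀ hn
end

section
/- Let (X,T) be a topological dynamical system. If the product system (X × X, T×T) is topologically deterministic, then (X, T^n) is topologically deterministic for every n ≥ 1. -/
open Filter Topology

/-- In a topologically deterministic system, every nonempty closed forward invariant set is
backward invariant: otherwise collapsing it to a point gives a non-invertible factor. -/
theorem TopDeterministic.mem_of_apply_mem_s4 {W : Type} [MetricSpace W] [CompactSpace W]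
    {f : W → W} (hf : Continuous f) (hsurj : Function.Surjective f)
    (hdet : TopDeterministic W f) {Z : Set W} (hZ : IsClosed Z) (hne : Z.Nonempty)
    (hinv : Set.MapsTo f Z Z) {w : W} (hw : f w ∈ Z) : w ∈ Z := by
  let F : C(W, C(W, ℝ)) := ContinuousMap.curry
    ⟨fun p : W × W => Metric.infDist p.1 Z * dist p.1 p.2,
      ((Metric.continuous_infDist_pt Z).comp continuous_fst).mul continuous_dist⟩
  have hF : ∀ a b, F a b = Metric.infDist a Z * dist a b := fun _ _ => rfl
  let Φ : W → ℝ × C(W, ℝ) := fun w => (Metric.infDist w Z, F w)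
  have hΦ : Continuous Φ := (Metric.continuous_infDist_pt Z).prodMk F.continuous
  have hzero : ∀ a, a ∈ Z ↔ Metric.infDist a Z = 0 := fun a => hZ.mem_iff_infDist_zero hne
  have hfib : ∀ a b, Φ a = Φ b ↔ a = b ∨ (a ∈ Z ∧ b ∈ Z) := by
    intro a b
    constructor
    · intro h
      have h1 : Metric.infDist a Z = Metric.infDist b Z := congrArg Prod.fst h
      have h2 : F a b = F b b := congrArg (fun p : ℝ × C(W, ℝ) => p.2 b) h
      rw [hF, hF, dist_self, mul_zero, mul_eq_zero] at h2
      rcases h2 with h2 | h2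
      · exact Or.inr ⟨(hzero a).2 h2, (hzero b).2 (h1 ▸ h2)⟩
      · exact Or.inl (dist_eq_zero.1 h2)
    · rintro (rfl | ⟨ha, hb⟩)
      · rfl
      · have ha' := (hzero a).1 ha
        have hb' := (hzero b).1 hb
        refine Prod.ext (ha'.trans hb'.symm) ?_
        ext c
        change F a c = F b c
        rw [hF, hF, ha', hb', zero_mul, zero_mul]
  have : CompactSpace (Set.range Φ) := isCompact_iff_compactSpace.1 (isCompact_range hΦ)
  let π : C(W, Set.range Φ) := ⟨Set.rangeFactorization Φ, hΦ.subtype_mk _⟩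
  have hπs : Function.Surjective π := Set.rangeFactorization_surjective
  have hπ : ∀ a b, π a = π b ↔ a = b ∨ (a ∈ Z ∧ b ∈ Z) := fun a b =>
    Subtype.ext_iff.trans (hfib a b)
  have hq : IsQuotientMap π := IsQuotientMap.of_surjective_continuous hπs π.continuous
  let g : C(W, Set.range Φ) := π.comp ⟨f, hf⟩
  have hg : Function.FactorsThrough g π := by
    intro a b hab
    rcases (hπ a b).1 hab with rfl | ⟨ha, hb⟩
    · rfl
    · exact (hπ _ _).2 (Or.inr ⟨hinv ha, hinv hb⟩)
  let S : C(Set.range Φ, Set.range Φ) := hq.lift g hg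
  have hS : ∀ a, S (π a) = π (f a) := fun a =>
    congrArg (fun h : C(W, Set.range Φ) => h a) (hq.lift_comp g hg)
  have hSs : Function.Surjective S := by
    intro y
    obtain ⟨b, rfl⟩ := hπs y
    obtain ⟨a, rfl⟩ := hsurj b
    exact ⟨π a, hS a⟩
  have hinj : Function.Injective S :=
    hdet _ S S.continuous hSs ⟨π, π.continuous, hπs, funext hS⟩
  obtain ⟨z, hz⟩ := hne
  have hSw : S (π w) = S (π z) := by
    rw [hS, hS]
    exact (hπ _ _).2 (Or.inr ⟨hw, hinv hz⟩)
  rcases (hπ w z).1 (hinj hSw) with rfl | h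
  · exact hz
  · exact h.1

/-- If `w` is a limit of its strict forward orbit under `f`, then it is also a limit of its strict
forward orbit under `f^[n]`. -/
theorem mem_closure_iterate_mul {W : Type} [TopologicalSpace W] {f : W → W} (hf : Continuous f)
    {w : W} (hw : w ∈ closure {v | ∃ m, 1 ≤ m ∧ f^[m] w = v}) {n : ℕ} (hn : 1 ≤ n) :
    w ∈ closure {v | ∃ k, 1 ≤ k ∧ f^[n * k] w = v} := by
  let D : ℕ → Set W := fun j => {v | ∃ m, 1 ≤ m ∧ m ≡ j [MOD n] ∧ f^[m] w = v}
  have hadd : ∀ i j, w ∈ closure (D i) → w ∈ closure (D j) → w ∈ closure (D (i + j)) := by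
    intro i j hi hj
    refine closure_minimal ?_ isClosed_closure hi
    rintro _ ⟨m, hm, hmi, rfl⟩
    refine map_mem_closure (hf.iterate m) hj ?_
    rintro _ ⟨l, hl, hlj, rfl⟩
    exact ⟨m + l, by omega, hmi.add hlj, Function.iterate_add_apply f m l w⟩
  obtain ⟨j, hj⟩ : ∃ j, w ∈ closure (D j) := by
    have hsub : {v | ∃ m, 1 ≤ m ∧ f^[m] w = v} ⊆ ⋃ j ∈ Finset.range n, D j := by
      rintro v ⟨m, hm, rfl⟩
      exact Set.mem_biUnion (x := m % n) (Finset.mem_coe.2 (Finset.mem_range.2 (Nat.mod_lt _ hn)))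
        ⟨m, hm, (Nat.mod_modEq m n).symm, rfl⟩
    have h := closure_mono hsub hw
    rw [Finset.closure_biUnion] at h
    obtain ⟨j, -, hj⟩ := Set.mem_iUnion₂.1 h
    exact ⟨j, hj⟩
  have hmul : ∀ k, w ∈ closure (D ((k + 1) * j)) := by
    intro k
    induction k with
    | zero => simpa using hj
    | succ k ih =>
      rw [Nat.succ_mul]
      exact hadd _ _ ih hj
  have hnj := hmul (n - 1)
  rw [Nat.sub_add_cancel hn] at hnj
  refine closure_mono ?_ hnj
  rintro _ ⟨m, hm, hmn, rfl⟩
  obtain ⟨k, rfl⟩ : n ∣ m :=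
    (Nat.modEq_zero_iff_dvd.1 (hmn.trans (Nat.modEq_zero_iff_dvd.2 (dvd_mul_right n j))))
  exact ⟨k, Nat.pos_of_mul_pos_left hm, rfl⟩

/-- Every point of a topologically deterministic system is a limit of its strict forward orbit. -/
theorem TopDeterministic.mem_closure_orbit {W : Type} [MetricSpace W] [CompactSpace W]
    {f : W → W} (hf : Continuous f) (hsurj : Function.Surjective f)
    (hdet : TopDeterministic W f) (w : W) : w ∈ closure {v | ∃ m, 1 ≤ m ∧ f^[m] w = v} := by
  have hmem : f w ∈ closure {v | ∃ m, 1 ≤ m ∧ f^[m] w = v} := subset_closure ⟨1, le_rfl, rfl⟩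
  refine hdet.mem_of_apply_mem_s4 hf hsurj isClosed_closure ⟨_, hmem⟩ ?_ hmem
  refine Set.MapsTo.closure ?_ hf
  rintro _ ⟨m, hm, rfl⟩
  exact ⟨m + 1, by omega, Function.iterate_succ_apply' f m w⟩

/-- if `(X × X, T×T)` is topologically deterministic then `(X, T^n)` is
topologically deterministic for every `n ≥ 1`. -/
theorem stmt4 {X : Type} [MetricSpace X] [CompactSpace X] (T : X → X)
    (hT : Continuous T) (hTsurj : Function.Surjective T)
    (hdet : TopDeterministic (X × X) (Prod.map T T)) :
    ∀ n : ℕ, 1 ≤ n → TopDeterministic X T^[n] := by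
  intro n hn Y _ _ S _ _ ⟨π, hπ, hπs, hcomm⟩ a b hab
  obtain ⟨x, rfl⟩ := hπs a
  obtain ⟨y, rfl⟩ := hπs b
  have hTT : Continuous (Prod.map T T) := hT.prodMap hT
  have hrec := mem_closure_iterate_mul hTT
    (hdet.mem_closure_orbit hTT (hTsurj.prodMap hTsurj) (x, y)) hn
  have hsemi : Function.Semiconj π T^[n] S := fun z => (congrFun hcomm z).symm
  have hclosed : IsClosed {p : X × X | π p.1 = π p.2} :=
    isClosed_eq (hπ.comp continuous_fst) (hπ.comp continuous_snd)
  refine closure_minimal ?_ hclosed hrec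
  rintro _ ⟨k, hk, rfl⟩
  obtain ⟨l, rfl⟩ := Nat.exists_eq_succ_of_ne_zero (Nat.one_le_iff_ne_zero.1 hk)
  change π ((Prod.map T T)^[n * (l + 1)] (x, y)).1 = π ((Prod.map T T)^[n * (l + 1)] (x, y)).2
  rw [Prod.map_iterate, Prod.map_fst, Prod.map_snd, Function.iterate_mul,
    (hsemi.iterate_right (l + 1)).eq, (hsemi.iterate_right (l + 1)).eq,
    Function.iterate_succ_apply, Function.iterate_succ_apply, hab]
end

section
/- There exists a topological dynamical system (X,T) with T a homeomorphism of X such that (X,T) is topologically deterministic but (X,T^{-1}) is not topologically deterministic. -/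
open Filter Topology

/-- A bundled topological dynamical system: a compact metric space together with a
continuous surjection. -/
structure TDSystem where
  X : Type
  [met : MetricSpace X]
  [cpt : CompactSpace X]
  T : X → X
  cont : Continuous T
  surj : Function.Surjective T

attribute [instance] TDSystem.met TDSystem.cpt

/-- The `k`-th digit of an integer in the factorial number system; it lies in `[0, k + 1]`. -/
def factDigit (k : ℕ) (m : ℤ) : ℤ := (m / ((k + 1).factorial : ℤ)) % ((k : ℤ) + 2)

lemma factDigit_nonneg (k : ℕ) (m : ℤ) : 0 ≤ factDigit k m :=
  Int.emod_nonneg _ (by omega)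

lemma factDigit_le (k : ℕ) (m : ℤ) : factDigit k m ≤ k + 1 := by
  have := Int.emod_lt_of_pos (m / ((k + 1).factorial : ℤ)) (show (0 : ℤ) < (k : ℤ) + 2 by omega)
  unfold factDigit
  omega

lemma exists_factorial_eq_mul {j k : ℕ} (h : j < k) :
    ∃ r : ℤ,
      ((k + 1).factorial : ℤ) = ((j + 1).factorial : ℤ) * (((j : ℤ) + 2) * r) := by
  obtain ⟨r, hr⟩ := Nat.factorial_dvd_factorial (show j + 2 ≤ k + 1 by omega)
  refine ⟨r, ?_⟩
  rw [hr, Nat.factorial_succ (j + 1)]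
  push_cast
  ring

lemma factDigit_add_factorial_of_lt {j k : ℕ} (h : j < k) (m : ℤ) :
    factDigit j (m + ((k + 1).factorial : ℤ)) = factDigit j m := by
  obtain ⟨r, hr⟩ := exists_factorial_eq_mul h
  have h0 : ((j + 1).factorial : ℤ) ≠ 0 := by positivity
  unfold factDigit
  rw [hr, Int.add_mul_ediv_left _ _ h0, Int.add_mul_emod_self_left]

lemma factDigit_add_factorial_self {k : ℕ} {m : ℤ} (h : factDigit k m ≠ k + 1) :
    factDigit k (m + ((k + 1).factorial : ℤ)) = factDigit k m + 1 := by
  have h0 : ((k + 1).factorial : ℤ) ≠ 0 := by positivity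
  have h1 := factDigit_nonneg k m
  have h2 := factDigit_le k m
  unfold factDigit at *
  rw [Int.add_ediv_of_dvd_right dvd_rfl, Int.ediv_self h0, ← Int.emod_add_emod,
    Int.emod_eq_of_lt] <;> omega

lemma factDigit_add_factorial_of_gt {j k : ℕ} (h : k < j) {m : ℤ} (hm : factDigit k m ≠ k + 1) :
    factDigit j (m + ((k + 1).factorial : ℤ)) = factDigit j m := by
  obtain ⟨r, hr⟩ := exists_factorial_eq_mul h
  have h0 : ((k + 1).factorial : ℤ) ≠ 0 := by positivity
  have h1 := factDigit_nonneg k m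
  have h2 := factDigit_le k m
  unfold factDigit at *
  have key (u : ℤ) (hu : u % ((k : ℤ) + 2) ≠ k + 1) :
      (u + 1) / ((k : ℤ) + 2) = u / ((k : ℤ) + 2) := by
    have hpos : (0 : ℤ) < (k : ℤ) + 2 := by omega
    have h3 := Int.emod_add_mul_ediv u ((k : ℤ) + 2)
    have h4 := Int.emod_nonneg u hpos.ne'
    have h5 := Int.emod_lt_of_pos u hpos
    rw [show u + 1 = (u % ((k : ℤ) + 2) + 1) + ((k : ℤ) + 2) * (u / ((k : ℤ) + 2)) by omega,
      Int.add_mul_ediv_left _ _ hpos.ne', Int.ediv_eq_zero_of_lt (by omega) (by omega), zero_add]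
  rw [hr, ← Int.ediv_ediv_of_nonneg (by positivity), ← Int.ediv_ediv_of_nonneg (by positivity),
    ← Int.ediv_ediv_of_nonneg (by positivity), ← Int.ediv_ediv_of_nonneg (by positivity),
    Int.add_ediv_of_dvd_right dvd_rfl, Int.ediv_self h0, key _ hm]

lemma exists_factDigit_eq_of_neg {m : ℤ} (hm : m < 0) : ∃ k : ℕ, factDigit k m = k + 1 := by
  refine ⟨m.natAbs, ?_⟩
  have h1 : m.natAbs + 1 ≤ (m.natAbs + 1).factorial := Nat.self_le_factorial _
  have h2 : m / ((m.natAbs + 1).factorial : ℤ) = -1 := by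
    rw [Int.ediv_eq_iff_of_pos (by positivity)]
    constructor <;> omega
  unfold factDigit
  rw [h2, ← Int.add_emod_right, Int.emod_eq_of_lt] <;> omega

/-- The supremum over `k` of the factorial digits, each divided by its largest value `k + 1`. -/
noncomputable def supDigit (m : ℤ) : ℝ := ⨆ k : ℕ, (factDigit k m : ℝ) / ((k : ℝ) + 1)

lemma factDigit_div_le_one (k : ℕ) (m : ℤ) : (factDigit k m : ℝ) / ((k : ℝ) + 1) ≤ 1 := by
  rw [div_le_one (by positivity)]
  exact_mod_cast factDigit_le k m

lemma factDigit_div_le_supDigit (k : ℕ) (m : ℤ) :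
    (factDigit k m : ℝ) / ((k : ℝ) + 1) ≤ supDigit m :=
  le_ciSup (f := fun k : ℕ => (factDigit k m : ℝ) / ((k : ℝ) + 1))
    ⟨1, by rintro _ ⟨k, rfl⟩; exact factDigit_div_le_one k m⟩ k

lemma supDigit_le_one (m : ℤ) : supDigit m ≤ 1 := ciSup_le fun k => factDigit_div_le_one k m

lemma supDigit_nonneg (m : ℤ) : 0 ≤ supDigit m := by
  refine le_trans ?_ (factDigit_div_le_supDigit 0 m)
  have : (0 : ℝ) ≤ factDigit 0 m := by exact_mod_cast factDigit_nonneg 0 m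
  positivity

lemma supDigit_eq_one {k : ℕ} {m : ℤ} (h : factDigit k m = k + 1) : supDigit m = 1 := by
  refine le_antisymm (supDigit_le_one m) ?_
  refine le_trans (le_of_eq ?_) (factDigit_div_le_supDigit k m)
  rw [h]
  push_cast
  rw [div_self (by positivity)]

lemma supDigit_of_neg {m : ℤ} (hm : m < 0) : supDigit m = 1 := by
  obtain ⟨k, hk⟩ := exists_factDigit_eq_of_neg hm
  exact supDigit_eq_one hk

lemma supDigit_zero : supDigit 0 = 0 := by
  simp [supDigit, factDigit]

lemma abs_supDigit_sub_le {k : ℕ} {m : ℤ} (h : factDigit k m ≠ k + 1) :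
    |supDigit (m + ((k + 1).factorial : ℤ)) - supDigit m| ≤ 1 / ((k : ℝ) + 1) := by
  have hpos : (0 : ℝ) < 1 / ((k : ℝ) + 1) := by positivity
  have digit_eq {j : ℕ} (hj : j ≠ k) :
      factDigit j (m + ((k + 1).factorial : ℤ)) = factDigit j m := by
    rcases lt_or_gt_of_ne hj with hj | hj
    · exact factDigit_add_factorial_of_lt hj m
    · exact factDigit_add_factorial_of_gt hj h
  have self_eq := factDigit_add_factorial_self h
  rw [abs_sub_le_iff, sub_le_iff_le_add, sub_le_iff_le_add]
  constructor <;> refine ciSup_le fun j => ?_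
  · have hle := factDigit_div_le_supDigit j m
    by_cases hj : j = k
    · subst hj
      rw [self_eq]
      push_cast
      rw [add_div]
      linarith
    · rw [digit_eq hj]
      linarith
  · have hle := factDigit_div_le_supDigit j (m + ((k + 1).factorial : ℤ))
    by_cases hj : j = k
    · subst hj
      rw [self_eq] at hle
      push_cast at hle
      rw [add_div] at hle
      linarith
    · rw [digit_eq hj] at hle
      linarith

/-- Bi-infinite sequences for which, at each place, at most one of the translations by `(k + 1)!`
changes the entry by more than `1 / (k + 1)`. -/
def almostPeriodicSeqs : Set (ℤ → unitInterval) :=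
  {y | ∀ m : ℤ, ∀ k j : ℕ, k < j →
    |(y (m + ((k + 1).factorial : ℤ)) : ℝ) - y m| ≤ 1 / ((k : ℝ) + 1) ∨
    |(y (m + ((j + 1).factorial : ℤ)) : ℝ) - y m| ≤ 1 / ((j : ℝ) + 1)}

lemma isClosed_almostPeriodicSeqs : IsClosed almostPeriodicSeqs := by
  simp only [almostPeriodicSeqs, Set.ofPred_forall]
  refine isClosed_iInter fun m => isClosed_iInter fun k => isClosed_iInter fun j =>
    isClosed_iInter fun _ => ?_
  have closed (i : ℕ) : IsClosed {y : ℤ → unitInterval |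
      |(y (m + ((i + 1).factorial : ℤ)) : ℝ) - y m| ≤ 1 / ((i : ℝ) + 1)} :=
    isClosed_le (continuous_abs.comp ((continuous_subtype_val.comp (continuous_apply _)).sub
      (continuous_subtype_val.comp (continuous_apply _)))) continuous_const
  exact (closed k).union (closed j)

lemma translate_mem_almostPeriodicSeqs {y : ℤ → unitInterval} (hy : y ∈ almostPeriodicSeqs)
    (a : ℤ) : (fun n => y (n + a)) ∈ almostPeriodicSeqs := by
  intro m k j hkj
  simpa only [add_right_comm] using hy (m + a) k j hkj

lemma const_mem_almostPeriodicSeqs (c : unitInterval) : (fun _ => c) ∈ almostPeriodicSeqs := by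
  intro m k j _
  left
  simp only [sub_self, abs_zero]
  positivity

lemma supDigit_mem_almostPeriodicSeqs :
    (fun m => (⟨supDigit m, supDigit_nonneg m, supDigit_le_one m⟩ : unitInterval)) ∈
      almostPeriodicSeqs := by
  intro m k j hkj
  by_cases h : factDigit k m = k + 1
  · right
    have h' : factDigit k (m + ((j + 1).factorial : ℤ)) = k + 1 := by
      rw [factDigit_add_factorial_of_lt hkj, h]
    simp only [supDigit_eq_one h, supDigit_eq_one h', sub_self, abs_zero]
    positivity
  · exact Or.inl (abs_supDigit_sub_le h)

lemma tendsto_add_factorial {y : ℤ → unitInterval} (hy : y ∈ almostPeriodicSeqs) (m : ℤ) :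
    Tendsto (fun k : ℕ => y (m + ((k + 1).factorial : ℤ))) atTop (𝓝 (y m)) := by
  rw [tendsto_subtype_rng, tendsto_iff_dist_tendsto_zero]
  refine squeeze_zero' (Eventually.of_forall fun _ => dist_nonneg) ?_
    tendsto_one_div_add_atTop_nhds_zero_nat
  simp only [Real.dist_eq]
  by_cases h : ∃ k : ℕ, ¬ |(y (m + ((k + 1).factorial : ℤ)) : ℝ) - y m| ≤ 1 / ((k : ℝ) + 1)
  · obtain ⟨k, hk⟩ := h
    filter_upwards [eventually_gt_atTop k] with j hj
    exact (hy m k j hj).resolve_left hk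
  · push Not at h
    exact Eventually.of_forall h

lemma continuous_translate (a : ℤ) :
    Continuous fun y : almostPeriodicSeqs => fun n => y.1 (n + a) :=
  continuous_pi fun n => (continuous_apply (n + a)).comp continuous_subtype_val

/-- The shift on `almostPeriodicSeqs`. -/
def shiftHomeo : almostPeriodicSeqs ≃ₜ almostPeriodicSeqs where
  toFun y := ⟨fun n => y.1 (n + 1), translate_mem_almostPeriodicSeqs y.2 1⟩
  invFun y := ⟨fun n => y.1 (n + -1), translate_mem_almostPeriodicSeqs y.2 (-1)⟩
  left_inv y := by ext n; simp
  right_inv y := by ext n; simp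
  continuous_toFun := (continuous_translate 1).subtype_mk _
  continuous_invFun := (continuous_translate (-1)).subtype_mk _

lemma iterate_shiftHomeo (n : ℕ) (y : almostPeriodicSeqs) (m : ℤ) :
    ((shiftHomeo^[n] y).1 m) = y.1 (m + n) := by
  induction n generalizing y with
  | zero => simp
  | succ n ih =>
    rw [Function.iterate_succ_apply, ih]
    simp [shiftHomeo, add_assoc]

lemma pointwiseRigid_shiftHomeo : PointwiseRigid shiftHomeo := by
  refine ⟨fun k => (k + 1).factorial,
    tendsto_atTop_mono (fun k => (Nat.le_succ k).trans (Nat.self_le_factorial _)) tendsto_id,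
    fun y => ?_⟩
  rw [tendsto_subtype_rng, tendsto_pi_nhds]
  intro m
  simp only [iterate_shiftHomeo]
  exact tendsto_add_factorial y.2 m

lemma PointwiseRigid.topDeterministic {X : Type} [MetricSpace X] [CompactSpace X] {T : X → X}
    (hT : PointwiseRigid T) : TopDeterministic X T := by
  rintro Y _ _ S - - ⟨π, hπ, hsurj, hsemi⟩ a b hab
  obtain ⟨x, rfl⟩ := hsurj a
  obtain ⟨y, rfl⟩ := hsurj b
  obtain ⟨n, hn, hlim⟩ := hT
  have hconj (k : ℕ) (z : X) : π (T^[k] z) = S^[k] (π z) :=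
    (Function.Semiconj.iterate_right (f := π) (fun z => (congrFun hsemi z).symm) k) z
  refine tendsto_nhds_unique_of_eventuallyEq ((hπ.tendsto x).comp (hlim x))
    ((hπ.tendsto y).comp (hlim y)) ?_
  filter_upwards [hn.eventually_ge_atTop 1] with k hk
  obtain ⟨l, hl⟩ := Nat.exists_eq_add_of_le' hk
  simp only [Function.comp_apply, hconj, hl]
  rw [Function.iterate_succ_apply, Function.iterate_succ_apply, hab]

/-- The restriction of a bi-infinite sequence to its negative places. -/
def past (y : almostPeriodicSeqs) : ℕ → unitInterval := fun i => y.1 (-1 - (i : ℤ))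

lemma continuous_past : Continuous past :=
  continuous_pi fun i : ℕ => (continuous_apply (-1 - (i : ℤ))).comp continuous_subtype_val

lemma past_shiftHomeo_symm (y : almostPeriodicSeqs) :
    past (shiftHomeo.symm y) = fun i => past y (i + 1) := by
  funext i
  change y.1 (-1 - (i : ℤ) + -1) = y.1 (-1 - ((i + 1 : ℕ) : ℤ))
  exact congrArg y.1 (by push_cast; ring)

/-- The one-sided shift induced on the pasts of the sequences in `almostPeriodicSeqs`. -/
def pastShift (z : Set.range past) : Set.range past :=
  ⟨fun i => z.1 (i + 1), by
    obtain ⟨y, hy⟩ := z.2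
    exact ⟨shiftHomeo.symm y, by rw [past_shiftHomeo_symm, hy]⟩⟩

lemma continuous_pastShift : Continuous pastShift :=
  have h : Continuous fun z : Set.range past => fun i : ℕ => z.1 (i + 1) :=
    continuous_pi fun i => (continuous_apply (i + 1)).comp continuous_subtype_val
  h.subtype_mk _

lemma isFactorMap_past :
    IsFactorMap shiftHomeo.symm pastShift (Set.rangeFactorization past) := by
  refine ⟨continuous_past.subtype_mk _, Set.rangeFactorization_surjective, ?_⟩
  funext y
  exact Subtype.ext (past_shiftHomeo_symm y).symm

lemma pastShift_surjective : Function.Surjective pastShift := by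
  have h : Function.Surjective (pastShift ∘ Set.rangeFactorization past) := by
    rw [isFactorMap_past.2.2]
    exact Set.rangeFactorization_surjective.comp shiftHomeo.symm.surjective
  exact h.of_comp

lemma not_injective_pastShift : ¬ Function.Injective pastShift := by
  intro hinj
  let a : almostPeriodicSeqs := shiftHomeo ⟨_, supDigit_mem_almostPeriodicSeqs⟩
  let b : almostPeriodicSeqs := ⟨_, const_mem_almostPeriodicSeqs 1⟩
  have hab : pastShift (Set.rangeFactorization past a) =
      pastShift (Set.rangeFactorization past b) := by
    refine Subtype.ext (funext fun i => Subtype.ext ?_)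
    change supDigit (-1 - ((i + 1 : ℕ) : ℤ) + 1) = 1
    exact supDigit_of_neg (by push_cast; omega)
  have h0 : supDigit (-1 - ((0 : ℕ) : ℤ) + 1) = 1 :=
    congrArg (fun z : Set.range past => (z.1 0 : ℝ)) (hinj hab)
  norm_num [supDigit_zero] at h0

instance : CompactSpace almostPeriodicSeqs :=
  isCompact_iff_compactSpace.mp isClosed_almostPeriodicSeqs.isCompact

instance : CompactSpace (Set.range past) :=
  isCompact_iff_compactSpace.mp (isCompact_range continuous_past)

/-- there exists a topological dynamical system `(X,T)` with `T` a
homeomorphism such that `(X,T)` is topologically deterministic but `(X,T⁻¹)` is not. -/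
theorem stmt5 :
    ∃ (S : TDSystem) (h : S.X ≃ₜ S.X), S.T = ⇑h ∧
      TopDeterministic S.X S.T ∧ ¬ TopDeterministic S.X ⇑h.symm := by
  let _ : MetricSpace almostPeriodicSeqs := TopologicalSpace.metrizableSpaceMetric _
  let _ : MetricSpace (Set.range past) := TopologicalSpace.metrizableSpaceMetric _
  refine ⟨⟨almostPeriodicSeqs, shiftHomeo, shiftHomeo.continuous, shiftHomeo.surjective⟩,
    shiftHomeo, rfl, pointwiseRigid_shiftHomeo.topDeterministic, fun hdet => ?_⟩
  exact not_injective_pastShift (hdet (Set.range past) pastShift continuous_pastShift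
    pastShift_surjective ⟨_, isFactorMap_past⟩)
end

section
/- There exists a topological dynamical system (X,T) such that (X,T) is topologically deterministic but the product system (X × X, T×T) is not topologically deterministic. -/
open Filter Topology

/-- The shift on bi-infinite real sequences. -/
def biShift (z : ℤ → ℝ) : ℤ → ℝ := fun t => z (t + 1)

lemma biShift_iterate (n : ℕ) (z : ℤ → ℝ) (t : ℤ) : biShift^[n] z t = z (t + n) := by
  induction n generalizing z with
  | zero => simp
  | succ n ih =>
    rw [Function.iterate_succ_apply, ih, biShift]
    push_cast
    congr 1
    ring

lemma continuous_biShift : Continuous biShift :=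
  continuous_pi fun t => continuous_apply (t + 1)

/-- The `j`-th (almost) period. -/
def tentPeriod (j : ℕ) : ℕ := 4 * (j + 2).factorial

lemma tentPeriod_pos (j : ℕ) : 0 < tentPeriod j :=
  Nat.mul_pos (by norm_num) (Nat.factorial_pos _)

/-- Sequences that are almost invariant under translation by `tentPeriod j`. -/
def AlmostPeriodicAt (j : ℕ) (z : ℤ → ℝ) : Prop :=
  ∀ t, |z (t + tentPeriod j) - z t| ≤ 4 / (j + 3)

/-- Sequences that, seen from any site `s`, are constantly `1` on the window of radius `j`
around one of `s + tentPeriod j` and `s + 2 * tentPeriod j`. -/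
def FlatAt (j : ℕ) (z : ℤ → ℝ) : Prop :=
  ∀ s : ℤ, (∀ t : ℤ, |t| ≤ j → z (s + tentPeriod j + t) = 1) ∨
    (∀ t : ℤ, |t| ≤ j → z (s + 2 * tentPeriod j + t) = 1)

/-- The subshift of sequences in `[0, 1]` that are almost periodic at the scales of parity `r`
and flat at the scales of the opposite parity. -/
def rigidSubshift (r : Bool) : Set (ℤ → ℝ) :=
  {z | (∀ t, z t ∈ Set.Icc (0 : ℝ) 1) ∧
    ∀ j : ℕ, (j.bodd = r → AlmostPeriodicAt j z) ∧ (j.bodd = !r → FlatAt j z)}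

lemma isClosed_almostPeriodicAt (j : ℕ) : IsClosed {z | AlmostPeriodicAt j z} := by
  simp only [AlmostPeriodicAt, Set.ofPred_forall]
  exact isClosed_iInter fun t => isClosed_le (by fun_prop) continuous_const

lemma isClosed_flatAt (j : ℕ) : IsClosed {z | FlatAt j z} := by
  simp only [FlatAt, Set.ofPred_forall, Set.ofPred_or]
  refine isClosed_iInter fun s => IsClosed.union ?_ ?_ <;>
  exact isClosed_iInter fun t => isClosed_iInter fun _ =>
    isClosed_eq (by fun_prop) continuous_const

lemma isCompact_rigidSubshift (r : Bool) : IsCompact (rigidSubshift r) := by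
  have hK : IsCompact (Set.pi Set.univ fun _ : ℤ => Set.Icc (0 : ℝ) 1) :=
    isCompact_univ_pi fun _ => isCompact_Icc
  refine hK.of_isClosed_subset ?_ fun z hz t _ => hz.1 t
  simp only [rigidSubshift, Set.ofPred_and, Set.ofPred_forall]
  refine IsClosed.inter (isClosed_iInter fun t => isClosed_Icc.preimage (continuous_apply t))
    (isClosed_iInter fun j => IsClosed.inter ?_ ?_)
  · exact isClosed_iInter fun _ => isClosed_almostPeriodicAt j
  · exact isClosed_iInter fun _ => isClosed_flatAt j

lemma translate_mem_rigidSubshift {r : Bool} {z : ℤ → ℝ} (hz : z ∈ rigidSubshift r) (a : ℤ) :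
    (fun t => z (t + a)) ∈ rigidSubshift r := by
  refine ⟨fun t => hz.1 _, fun j => ⟨fun hj t => ?_, fun hj s => ?_⟩⟩
  · simpa only [add_right_comm] using (hz.2 j).1 hj (t + a)
  · simpa only [add_right_comm] using (hz.2 j).2 hj (s + a)

lemma one_mem_rigidSubshift (r : Bool) : (fun _ => 1 : ℤ → ℝ) ∈ rigidSubshift r := by
  refine ⟨fun t => by simp, fun j => ⟨fun _ t => ?_, fun _ s => Or.inl fun _ _ => rfl⟩⟩
  simp only [sub_self, abs_zero]
  positivity

lemma tendsto_scale (r : Bool) : Tendsto (fun i : ℕ => 2 * i + r.toNat) atTop atTop :=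
  tendsto_atTop_mono (fun i => by simp only [id]; omega) tendsto_id

lemma bodd_scale (r : Bool) (i : ℕ) : (2 * i + r.toNat).bodd = r := by
  cases r <;> simp

/-- Iteration times comparable to one or two almost periods bring every point back to itself. -/
lemma tendsto_biShift_self {r : Bool} {z : ℤ → ℝ} (hz : z ∈ rigidSubshift r) {n : ℕ → ℕ}
    (hn : ∀ i, n i = tentPeriod (2 * i + r.toNat) ∨ n i = 2 * tentPeriod (2 * i + r.toNat)) :
    Tendsto (fun i => biShift^[n i] z) atTop (𝓝 z) := by
  refine tendsto_pi_nhds.2 fun t => ?_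
  simp only [biShift_iterate]
  rw [tendsto_iff_dist_tendsto_zero]
  have hlim : Tendsto (fun i : ℕ => 8 / (((2 * i + r.toNat : ℕ) : ℝ) + 3)) atTop (𝓝 0) :=
    Tendsto.div_atTop tendsto_const_nhds
      (tendsto_atTop_add_const_right _ _ (tendsto_natCast_atTop_atTop.comp (tendsto_scale r)))
  refine squeeze_zero (fun _ => dist_nonneg) (fun i => ?_) hlim
  have h1 := (hz.2 _).1 (bodd_scale r i) t
  have h2 := (hz.2 _).1 (bodd_scale r i) (t + tentPeriod (2 * i + r.toNat))
  have h8 : (8 : ℝ) / (((2 * i + r.toNat : ℕ) : ℝ) + 3)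
      = 4 / (((2 * i + r.toNat : ℕ) : ℝ) + 3) + 4 / (((2 * i + r.toNat : ℕ) : ℝ) + 3) := by ring
  have h0 := (abs_nonneg _).trans h1
  rw [Real.dist_eq, h8]
  rcases hn i with h | h
  · rw [h]; linarith
  · have e : t + ((n i : ℕ) : ℤ)
        = t + tentPeriod (2 * i + r.toNat) + tentPeriod (2 * i + r.toNat) := by
      rw [h]; push_cast; ring
    rw [e]
    exact (abs_sub_le _ _ _).trans (add_le_add h2 h1)

/-- Points of the two subshifts can be moved so that the first one nearly returns while the
second one approaches the constant sequence `1`. -/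
lemma exists_tendsto_self_and_one {r : Bool} {u v : ℤ → ℝ} (hu : u ∈ rigidSubshift r)
    (hv : v ∈ rigidSubshift (!r)) :
    ∃ n : ℕ → ℕ, (∀ i, 0 < n i) ∧ Tendsto (fun i => biShift^[n i] u) atTop (𝓝 u) ∧
      Tendsto (fun i => biShift^[n i] v) atTop (𝓝 fun _ => 1) := by
  have key : ∀ i : ℕ, ∃ m : ℕ,
      (m = tentPeriod (2 * i + r.toNat) ∨ m = 2 * tentPeriod (2 * i + r.toNat)) ∧
      ∀ t : ℤ, |t| ≤ (2 * i + r.toNat : ℕ) → v (t + m) = 1 := by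
    intro i
    have hj : (2 * i + r.toNat).bodd = !!r := by rw [bodd_scale, Bool.not_not]
    rcases (hv.2 _).2 hj 0 with h | h
    · refine ⟨_, Or.inl rfl, fun t ht => ?_⟩
      rw [← h t ht]; congr 1; ring
    · refine ⟨_, Or.inr rfl, fun t ht => ?_⟩
      rw [← h t ht]; congr 1; push_cast; ring
  choose n hn hv1 using key
  refine ⟨n, fun i => ?_, tendsto_biShift_self hu hn, tendsto_pi_nhds.2 fun t => ?_⟩
  · have := tentPeriod_pos (2 * i + r.toNat)
    rcases hn i with h | h <;> omega
  · refine tendsto_const_nhds.congr' ?_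
    filter_upwards [(tendsto_scale r).eventually_ge_atTop t.natAbs] with i hi
    rw [biShift_iterate, hv1 i t (by rw [Int.abs_eq_natAbs]; exact_mod_cast hi)]

/-- The `tentPeriod j`-periodic sequence vanishing at the multiples of the period and rising
linearly to `1` within distance `(j + 1)!`. -/
noncomputable def tent (j : ℕ) (t : ℤ) : ℝ :=
  min 1 (‖((t : ℝ) : AddCircle (tentPeriod j : ℝ))‖ / (j + 1).factorial)

lemma tent_nonneg (j : ℕ) (t : ℤ) : 0 ≤ tent j t :=
  le_min zero_le_one (by positivity)

lemma tent_le_one (j : ℕ) (t : ℤ) : tent j t ≤ 1 := min_le_left _ _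

lemma tent_zero (j : ℕ) : tent j 0 = 0 := by simp [tent]

lemma le_norm_coe_addCircle {p a x : ℝ} (hp : 0 < p) (h1 : a ≤ x) (h2 : x ≤ p - a) :
    a ≤ ‖(x : AddCircle p)‖ := by
  rw [AddCircle.norm_eq]
  rcases le_or_gt (round (p⁻¹ * x)) 0 with h | h
  · have h' : ((round (p⁻¹ * x) : ℤ) : ℝ) ≤ 0 := by exact_mod_cast h
    exact le_trans (by nlinarith) (le_abs_self _)
  · have h' : (1 : ℝ) ≤ ((round (p⁻¹ * x) : ℤ) : ℝ) := by exact_mod_cast h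
    exact le_trans (by nlinarith) (neg_le_abs _)

lemma tent_eq_one_of_le {j : ℕ} {t : ℤ}
    (h : ((j + 1).factorial : ℝ) ≤ ‖((t : ℝ) : AddCircle (tentPeriod j : ℝ))‖) :
    tent j t = 1 :=
  min_eq_left ((one_le_div (by positivity)).2 h)

lemma tent_add_of_dvd {j m : ℕ} (h : tentPeriod j ∣ m) (t : ℤ) : tent j (t + m) = tent j t := by
  obtain ⟨k, rfl⟩ := h
  have : (((t + ((tentPeriod j * k : ℕ) : ℤ) : ℤ) : ℝ) : AddCircle (tentPeriod j : ℝ))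
      = ((t : ℝ) : AddCircle (tentPeriod j : ℝ)) := by
    push_cast
    rw [AddCircle.coe_add, mul_comm, ← nsmul_eq_mul, AddCircle.coe_nsmul, AddCircle.coe_period,
      smul_zero, add_zero]
  rw [tent, tent, this]

lemma abs_tent_add_sub_le (j m : ℕ) (t : ℤ) :
    |tent j (t + m) - tent j t| ≤ m / (j + 1).factorial := by
  refine (abs_min_sub_min_le_max _ _ _ _).trans (max_le (by simp; positivity) ?_)
  rw [← sub_div, abs_div, abs_of_pos (show (0 : ℝ) < (j + 1).factorial by positivity)]
  gcongr
  refine (abs_norm_sub_norm_le _ _).trans ?_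
  rw [← AddCircle.coe_sub]
  refine (QuotientAddGroup.norm_mk_le_norm).trans ?_
  simp

lemma tentPeriod_dvd {i j : ℕ} (h : i ≤ j) : tentPeriod i ∣ tentPeriod j :=
  Nat.mul_dvd_mul_left 4 (Nat.factorial_dvd_factorial (by omega))

/-- The supremum of the tents of parity `r`. -/
noncomputable def tentSup (r : Bool) (t : ℤ) : ℝ :=
  ⨆ j : ℕ, if j.bodd = r then tent j t else 0

lemma bddAbove_tents (r : Bool) (t : ℤ) :
    BddAbove (Set.range fun j : ℕ => if j.bodd = r then tent j t else 0) := by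
  refine ⟨1, ?_⟩
  rintro _ ⟨j, rfl⟩
  dsimp only
  split_ifs
  exacts [tent_le_one _ _, zero_le_one]

lemma tentSup_le {r : Bool} {t : ℤ} {a : ℝ} (ha : 0 ≤ a)
    (h : ∀ j : ℕ, j.bodd = r → tent j t ≤ a) : tentSup r t ≤ a := by
  refine ciSup_le fun j => ?_
  split_ifs with hj
  exacts [h j hj, ha]

lemma tent_le_tentSup {r : Bool} {j : ℕ} (hj : j.bodd = r) (t : ℤ) : tent j t ≤ tentSup r t := by
  have h := le_ciSup (bddAbove_tents r t) j
  rwa [if_pos hj] at h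

lemma tentSup_mem_Icc (r : Bool) (t : ℤ) : tentSup r t ∈ Set.Icc (0 : ℝ) 1 :=
  ⟨(tent_nonneg _ t).trans (tent_le_tentSup (bodd_scale r 0) t),
    tentSup_le zero_le_one fun j _ => tent_le_one j t⟩

lemma tentSup_zero (r : Bool) : tentSup r 0 = 0 :=
  le_antisymm (tentSup_le le_rfl fun j _ => (tent_zero j).le) (tentSup_mem_Icc r 0).1

lemma tentSup_eq_one {r : Bool} {j : ℕ} (hj : j.bodd = r) {t : ℤ} (h : tent j t = 1) :
    tentSup r t = 1 :=
  le_antisymm (tentSup_mem_Icc r t).2 (h ▸ tent_le_tentSup hj t)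

lemma abs_tent_add_tentPeriod_sub_le {i j : ℕ} (hij : i.bodd = j.bodd) (t : ℤ) :
    |tent i (t + tentPeriod j) - tent i t| ≤ 4 / (j + 3) := by
  rcases le_or_gt i j with h | h
  · rw [tent_add_of_dvd (tentPeriod_dvd h), sub_self, abs_zero]
    positivity
  · have h2 : j + 2 ≤ i := by
      rcases Nat.lt_or_ge i (j + 2) with h' | h'
      · obtain rfl : i = j + 1 := by omega
        simp [Nat.bodd_succ] at hij
      · exact h'
    refine (abs_tent_add_sub_le i _ t).trans ?_
    have hf : (j + 3).factorial ≤ (i + 1).factorial := Nat.factorial_le (by omega)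
    have hf' : ((j + 3 : ℕ) : ℝ) * (j + 2).factorial ≤ (i + 1).factorial := by
      rw [Nat.factorial_succ] at hf; exact_mod_cast hf
    rw [div_le_div_iff₀ (by positivity) (by positivity)]
    simp only [tentPeriod]
    push_cast at hf' ⊢
    linarith

lemma almostPeriodicAt_tentSup (j : ℕ) : AlmostPeriodicAt j (tentSup j.bodd) := by
  intro t
  have h0 : (0 : ℝ) ≤ 4 / (j + 3) := by positivity
  rw [abs_sub_le_iff]
  constructor <;> rw [sub_le_iff_le_add] <;>
  refine tentSup_le (add_nonneg h0 (tentSup_mem_Icc _ _).1) fun i hi => ?_ <;>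
  have h1 := abs_sub_le_iff.1 (abs_tent_add_tentPeriod_sub_le hi t)
  · linarith [tent_le_tentSup hi t]
  · linarith [tent_le_tentSup hi (t + tentPeriod j)]

lemma flatAt_tentSup {j : ℕ} {r : Bool} (hj : j.bodd = !r) : FlatAt j (tentSup r) := by
  intro s
  by_contra! hcon
  obtain ⟨⟨a, ha, hza⟩, ⟨b, hb, hzb⟩⟩ := hcon
  have hr : (j + 1).bodd = r := by simp [Nat.bodd_succ, hj]
  have ha1 := not_le.1 fun h => hza (tentSup_eq_one hr (tent_eq_one_of_le h))
  have hb1 := not_le.1 fun h => hzb (tentSup_eq_one hr (tent_eq_one_of_le h))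
  have hjf : (j : ℝ) ≤ (j + 2).factorial := by
    exact_mod_cast (show j ≤ j + 2 by omega).trans (Nat.self_le_factorial _)
  have hp : 0 < (tentPeriod (j + 1) : ℝ) := by exact_mod_cast tentPeriod_pos _
  have haj : |(a : ℝ)| ≤ j := by exact_mod_cast ha
  have hbj : |(b : ℝ)| ≤ j := by exact_mod_cast hb
  rw [abs_le] at haj hbj
  have hstep : ((j + 3 : ℕ) : ℝ) * (j + 2).factorial = (j + 3).factorial := by
    rw [Nat.factorial_succ (j + 2)]; push_cast; ring
  have hlow : (2 * (j + 2).factorial : ℝ)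
      ≤ ‖(((tentPeriod j : ℝ) + b - a : ℝ) : AddCircle (tentPeriod (j + 1) : ℝ))‖ := by
    have hf0 : (0 : ℝ) < (j + 2).factorial := by positivity
    have hj0 : (0 : ℝ) ≤ j := by positivity
    refine le_norm_coe_addCircle hp ?_ ?_ <;> simp only [tentPeriod] <;> push_cast at hstep ⊢
    · linarith
    · nlinarith [mul_nonneg hj0 hf0.le]
  have htri : ‖(((tentPeriod j : ℝ) + b - a : ℝ) : AddCircle (tentPeriod (j + 1) : ℝ))‖
      < 2 * (j + 2).factorial := by
    have e : ((tentPeriod j : ℝ) + b - a)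
        = ((s + 2 * tentPeriod j + b : ℤ) : ℝ) - ((s + tentPeriod j + a : ℤ) : ℝ) := by
      push_cast; ring
    rw [e, AddCircle.coe_sub]
    refine (norm_sub_le _ _).trans_lt ?_
    linarith
  linarith

lemma tentSup_mem_rigidSubshift (r : Bool) : tentSup r ∈ rigidSubshift r :=
  ⟨tentSup_mem_Icc r, fun j => ⟨fun hj => hj ▸ almostPeriodicAt_tentSup j, flatAt_tentSup⟩⟩

lemma exists_tentSup_eq_one {n : ℕ} (hn : 0 < n) : ∃ r, tentSup r n = 1 := by
  obtain ⟨j, hj1, hj2⟩ : ∃ j : ℕ, (j + 1).factorial ≤ n ∧ n < (j + 2).factorial := by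
    have hex : ∃ k : ℕ, n < (k + 1).factorial :=
      ⟨n, (Nat.lt_succ_self n).trans_le (Nat.self_le_factorial _)⟩
    classical
    have hspec := Nat.find_spec hex
    have hmin := fun m => Nat.find_min (m := m) hex
    cases h : Nat.find hex with
    | zero => rw [h] at hspec; simp at hspec; omega
    | succ j => exact ⟨j, not_lt.1 (hmin j (by omega)), by simpa [h] using hspec⟩
  refine ⟨j.bodd, tentSup_eq_one rfl (tent_eq_one_of_le ?_)⟩
  have h1 : ((j + 1).factorial : ℝ) ≤ n := by exact_mod_cast hj1
  have h2 : (n : ℝ) < (j + 2).factorial := by exact_mod_cast hj2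
  refine le_norm_coe_addCircle (by exact_mod_cast tentPeriod_pos j) (by simpa using h1) ?_
  simp only [tentPeriod]
  push_cast
  linarith

/-- The union of the two rigid subshifts. -/
def rigidUnion : Set (ℤ → ℝ) := {z | ∃ r, z ∈ rigidSubshift r}

lemma isCompact_rigidUnion : IsCompact rigidUnion := by
  have : rigidUnion = ⋃ r, rigidSubshift r := by ext; simp [rigidUnion]
  rw [this]
  exact isCompact_iUnion isCompact_rigidSubshift

/-- The shift on the union of the two rigid subshifts. -/
def rigidUnionShift (z : rigidUnion) : rigidUnion :=
  ⟨biShift z, z.2.imp fun _ hr => translate_mem_rigidSubshift hr 1⟩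

lemma continuous_rigidUnionShift : Continuous rigidUnionShift :=
  (continuous_biShift.comp continuous_subtype_val).subtype_mk _

lemma surjective_rigidUnionShift : Function.Surjective rigidUnionShift := fun z =>
  ⟨⟨fun t => z.1 (t + -1), z.2.imp fun _ hr => translate_mem_rigidSubshift hr (-1)⟩,
    Subtype.ext <| funext fun t => by simp [rigidUnionShift, biShift]⟩

lemma coe_rigidUnionShift_iterate (n : ℕ) (z : rigidUnion) :
    (rigidUnionShift^[n] z : ℤ → ℝ) = biShift^[n] z := by
  induction n generalizing z with
  | zero => rfl
  | succ n ih => rw [Function.iterate_succ_apply, ih]; rfl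

lemma map_limit_eq_of_map_eq {X Y : Type} [TopologicalSpace X] [TopologicalSpace Y] [T2Space Y]
    {T : X → X} {S : Y → Y} {π : X → Y} (hπ : Continuous π) (hS : S ∘ π = π ∘ T)
    {u v u' v' : X} (huv : S (π u) = S (π v)) {n : ℕ → ℕ} (hn : ∀ i, 0 < n i)
    (hu : Tendsto (fun i => T^[n i] u) atTop (𝓝 u'))
    (hv : Tendsto (fun i => T^[n i] v) atTop (𝓝 v')) : π u' = π v' := by
  have hsemi : Function.Semiconj π T S := fun x => (congrFun hS x).symm
  refine tendsto_nhds_unique ((hπ.tendsto _).comp hu) (((hπ.tendsto _).comp hv).congr fun i => ?_)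
  obtain ⟨m, hm⟩ := Nat.exists_eq_succ_of_ne_zero (hn i).ne'
  rw [Function.comp_apply, Function.comp_apply, (hsemi.iterate_right (n i)).eq,
    (hsemi.iterate_right (n i)).eq, hm, Function.iterate_succ_apply, Function.iterate_succ_apply,
    huv]

/-- A continuous observable that vanishes along a forward orbit after time zero, but not at time
zero, produces a non-injective factor as soon as it vanishes along some full forward orbit. -/
lemma not_topDeterministic_of_observable {X : Type} [MetricSpace X] [CompactSpace X] {T : X → X}
    (hT : Continuous T) (hsurj : Function.Surjective T) {φ : X → ℝ} (hφ : Continuous φ) {x y : X}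
    (hx0 : φ x ≠ 0) (hx : ∀ n, 0 < n → φ (T^[n] x) = 0) (hy : ∀ n, φ (T^[n] y) = 0) :
    ¬ TopDeterministic X T := by
  intro h
  let f : X → ℕ → ℝ := fun z n => φ (T^[n] z)
  have hf : Continuous f := continuous_pi fun n => hφ.comp (hT.iterate n)
  let S : Set.range f → Set.range f := fun a => ⟨fun n => a.1 (n + 1), by
    obtain ⟨_, z, rfl⟩ := a
    exact ⟨T z, rfl⟩⟩
  have hSc : Continuous S := Continuous.subtype_mk
    (continuous_pi fun n => (continuous_apply (A := fun _ : ℕ => ℝ) (n + 1)).comp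
      continuous_subtype_val) _
  let _ : MetricSpace (Set.range f) := TopologicalSpace.metrizableSpaceMetric _
  have _ : CompactSpace (Set.range f) := isCompact_iff_compactSpace.1 (isCompact_range hf)
  have hSs : Function.Surjective S := by
    rintro ⟨_, z, rfl⟩
    obtain ⟨w, rfl⟩ := hsurj z
    exact ⟨⟨f w, w, rfl⟩, rfl⟩
  have hinj := h (Set.range f) S hSc hSs
    ⟨Set.rangeFactorization f, hf.subtype_mk _, Set.rangeFactorization_surjective, rfl⟩
  have heq : (⟨f x, x, rfl⟩ : Set.range f) = ⟨f y, y, rfl⟩ := hinj <| Subtype.ext <| funext fun n =>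
    (hx (n + 1) n.succ_pos).trans (hy (n + 1)).symm
  exact hx0 ((congrFun (congrArg Subtype.val heq) 0).trans (hy 0))

noncomputable instance : MetricSpace rigidUnion := TopologicalSpace.metrizableSpaceMetric _

instance : CompactSpace rigidUnion := isCompact_iff_compactSpace.1 isCompact_rigidUnion

lemma topDeterministic_rigidUnionShift : TopDeterministic rigidUnion rigidUnionShift := by
  rintro Y _ _ S - - ⟨π, hπ, hsurj, hS⟩ a b hab
  obtain ⟨u, rfl⟩ := hsurj a
  obtain ⟨v, rfl⟩ := hsurj b
  have lift : ∀ {n : ℕ → ℕ} {z w : rigidUnion},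
      Tendsto (fun i => biShift^[n i] (z : ℤ → ℝ)) atTop (𝓝 w) →
      Tendsto (fun i => rigidUnionShift^[n i] z) atTop (𝓝 w) := fun h =>
    tendsto_subtype_rng.2 (by simpa only [coe_rigidUnionShift_iterate] using h)
  let e : rigidUnion := ⟨fun _ => 1, true, one_mem_rigidSubshift true⟩
  have mixed : ∀ {r : Bool} {z w : rigidUnion}, z.1 ∈ rigidSubshift r → w.1 ∈ rigidSubshift (!r) →
      S (π z) = S (π w) → π z = π e := fun hz hw hzw => by
    obtain ⟨n, hn, h1, h2⟩ := exists_tendsto_self_and_one hz hw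
    exact map_limit_eq_of_map_eq hπ hS hzw hn (lift h1) (lift (w := e) h2)
  obtain ⟨r, hu⟩ := u.2
  obtain ⟨q, hv⟩ := v.2
  rcases Bool.eq_or_eq_not q r with rfl | rfl
  · exact map_limit_eq_of_map_eq hπ hS hab (fun i => tentPeriod_pos _)
      (lift (tendsto_biShift_self hu fun i => Or.inl rfl))
      (lift (tendsto_biShift_self hv fun i => Or.inl rfl))
  · exact (mixed hu hv hab).trans (mixed hv (by rwa [Bool.not_not]) hab.symm).symm

lemma not_topDeterministic_prodMap_rigidUnionShift :
    ¬ TopDeterministic (rigidUnion × rigidUnion) (Prod.map rigidUnionShift rigidUnionShift) := by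
  let φ : rigidUnion × rigidUnion → ℝ := fun p => 1 - max (p.1.1 0) (p.2.1 0)
  have hφ : Continuous φ := continuous_const.sub
    (((continuous_apply 0).comp (continuous_subtype_val.comp continuous_fst)).max
      ((continuous_apply 0).comp (continuous_subtype_val.comp continuous_snd)))
  have hiter : ∀ (n : ℕ) (z w : rigidUnion),
      φ ((Prod.map rigidUnionShift rigidUnionShift)^[n] (z, w)) = 1 - max (z.1 n) (w.1 n) := by
    intro n z w
    simp [φ, Prod.map_iterate, coe_rigidUnionShift_iterate, biShift_iterate]
  let x : Bool → rigidUnion := fun r => ⟨tentSup r, r, tentSup_mem_rigidSubshift r⟩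
  let e : rigidUnion := ⟨fun _ => 1, true, one_mem_rigidSubshift true⟩
  refine not_topDeterministic_of_observable
    (continuous_rigidUnionShift.prodMap continuous_rigidUnionShift)
    (surjective_rigidUnionShift.prodMap surjective_rigidUnionShift) hφ
    (x := (x false, x true)) (y := (e, e)) ?_ (fun n hn => ?_) (fun n => ?_)
  · simp [φ, x, tentSup_zero]
  · rw [hiter]
    obtain ⟨r, hr⟩ := exists_tentSup_eq_one hn
    have h0 := (tentSup_mem_Icc false n).2
    have h1 := (tentSup_mem_Icc true n).2
    cases r
    · simp only [x, hr, max_eq_left h1, sub_self]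
    · simp only [x, hr, max_eq_right h0, sub_self]
  · rw [hiter]
    simp [e]

/-- there exists a topological dynamical system `(X,T)` that is
topologically deterministic but whose product `(X × X, T×T)` is not. -/
theorem stmt6 :
    ∃ S : TDSystem,
      TopDeterministic S.X S.T ∧
      ¬ TopDeterministic (S.X × S.X) (Prod.map S.T S.T) :=
  ⟨⟨rigidUnion, rigidUnionShift, continuous_rigidUnionShift, surjective_rigidUnionShift⟩,
    topDeterministic_rigidUnionShift, not_topDeterministic_prodMap_rigidUnionShift⟩
end

section
/- Let (X,T) be a topological dynamical system. Suppose that for every (x',x'') ∈ X × X, either (x',x'') is forward recurrent for T×T, or there exists p ∈ X such that both (x',p) and (p,x'') belong to the ω-limit set ω_{T×T}(x',x''). Then (X,T) is topologically deterministic. -/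
open Filter Topology

/-- If `S (π a) = S (π b)`, every forward iterate of `(a, b)` lies in the kernel of `π`. -/
theorem IsFactorMap.iterate_prodMap_mem {X Y : Type} [TopologicalSpace X] [TopologicalSpace Y]
    {T : X → X} {S : Y → Y} {π : X → Y} (hπ : IsFactorMap T S π) {a b : X}
    (hab : S (π a) = S (π b)) {n : ℕ} (hn : 1 ≤ n) :
    (Prod.map T T)^[n] (a, b) ∈ {q : X × X | π q.1 = π q.2} := by
  have hsc : Function.Semiconj π T S := fun x => (congrFun hπ.2.2 x).symm
  obtain ⟨m, rfl⟩ := Nat.exists_eq_add_of_le' hn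
  simp only [Prod.map_iterate, Set.mem_ofPred_eq, Prod.map_apply]
  rw [(hsc.iterate_right _).eq, (hsc.iterate_right _).eq, Function.iterate_succ_apply,
    Function.iterate_succ_apply, hab]

/-- A closed set containing all forward iterates of a point contains its ω-limit set. -/
theorem omegaSet_subset_of_isClosed {X : Type} [TopologicalSpace X] {f : X → X} {y : X}
    {K : Set X} (hK : IsClosed K) (h : ∀ n, 1 ≤ n → f^[n] y ∈ K) : omegaSet f y ⊆ K := by
  refine (Set.biInter_subset_of_mem (Set.mem_Ici.2 le_rfl)).trans (closure_minimal ?_ hK)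
  rintro _ ⟨n, hn, rfl⟩
  exact h n hn

/-- A closed set containing all forward iterates of a forward recurrent point contains it. -/
theorem ForwardRecurrent.mem_of_isClosed {X : Type} [TopologicalSpace X] {f : X → X} {y : X}
    (hy : ForwardRecurrent f y) {K : Set X} (hK : IsClosed K) (h : ∀ n, 1 ≤ n → f^[n] y ∈ K) :
    y ∈ K := by
  obtain ⟨n, hn, hlim⟩ := hy
  exact hK.mem_of_tendsto hlim ((hn.eventually_ge_atTop 1).mono fun k hk => h _ hk)

/-- if every `(x',x'') ∈ X × X` is either forward recurrent for `T×T`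
or admits `p ∈ X` with `(x',p), (p,x'') ∈ ω_{T×T}(x',x'')`, then `(X,T)` is
topologically deterministic. -/
theorem stmt7 {X : Type} [MetricSpace X] [CompactSpace X] (T : X → X)
    (hT : Continuous T) (hTsurj : Function.Surjective T)
    (hyp : ∀ x' x'' : X,
      ForwardRecurrent (Prod.map T T) (x', x'') ∨
      ∃ p : X, (x', p) ∈ omegaSet (Prod.map T T) (x', x'') ∧
               (p, x'') ∈ omegaSet (Prod.map T T) (x', x'')) :
    TopDeterministic X T := by
  intro Y _ _ S _ _ ⟨π, hπ⟩ y₁ y₂ hy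
  obtain ⟨x', rfl⟩ := hπ.2.1 y₁
  obtain ⟨x'', rfl⟩ := hπ.2.1 y₂
  have hK : IsClosed {q : X × X | π q.1 = π q.2} :=
    isClosed_eq (hπ.1.comp continuous_fst) (hπ.1.comp continuous_snd)
  have hiter := fun n (hn : 1 ≤ n) => hπ.iterate_prodMap_mem hy hn
  rcases hyp x' x'' with hrec | ⟨p, hp₁, hp₂⟩
  · exact hrec.mem_of_isClosed hK hiter
  · have hsub := omegaSet_subset_of_isClosed hK hiter
    have h₁ : π x' = π p := hsub hp₁
    exact h₁.trans (hsub hp₂)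
end

section
/- Let (X,T) be a topological dynamical system. If (X,T) is pointwise rigid, then (X,T) is topologically deterministic. -/
open Filter Topology

theorem PointwiseRigid.of_isFactorMap {X Y : Type} [TopologicalSpace X] [TopologicalSpace Y]
    {T : X → X} {S : Y → Y} {π : X → Y} (hT : PointwiseRigid T) (hπ : IsFactorMap T S π) :
    PointwiseRigid S := by
  obtain ⟨n, hn, hlim⟩ := hT
  obtain ⟨hcont, hsurj, hcomm⟩ := hπ
  have hsemi : Function.Semiconj π T S := fun x => (congrFun hcomm x).symm
  refine ⟨n, hn, fun y => ?_⟩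
  obtain ⟨x, rfl⟩ := hsurj y
  exact ((hcont.tendsto x).comp (hlim x)).congr fun k => (hsemi.iterate_right (n k)) x

theorem PointwiseRigid.injective {Y : Type} [TopologicalSpace Y] [T2Space Y] {S : Y → Y}
    (hS : PointwiseRigid S) : Function.Injective S := by
  obtain ⟨n, hn, hlim⟩ := hS
  intro a b hab
  refine tendsto_nhds_unique_of_eventuallyEq (hlim a) (hlim b) ?_
  filter_upwards [hn.eventually_ge_atTop 1] with k hk
  obtain ⟨m, hm⟩ := Nat.exists_eq_add_of_le' hk
  rw [hm, Function.iterate_succ_apply, Function.iterate_succ_apply, hab]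

/-- if `(X,T)` is pointwise rigid then `(X,T)` is topologically
deterministic. -/
theorem stmt9 {X : Type} [MetricSpace X] [CompactSpace X] (T : X → X)
    (hT : Continuous T) (hTsurj : Function.Surjective T)
    (hrig : PointwiseRigid T) :
    TopDeterministic X T := by
  rintro Y _ _ S - - ⟨π, hπ⟩
  exact (hrig.of_isFactorMap hπ).injective
end

section
/- Let (X,T) be a topological dynamical system and let n ≥ 1. If (X,T^n) is topologically deterministic, then (X,T) is topologically deterministic. -/
open Filter Topology

/-- if `(X,T^n)` is topologically deterministic for some `n ≥ 1`,
then `(X,T)` is topologically deterministic. -/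
theorem stmt10 {X : Type} [MetricSpace X] [CompactSpace X] (T : X → X)
    (hT : Continuous T) (hTsurj : Function.Surjective T)
    (n : ℕ) (hn : 1 ≤ n) (hdet : TopDeterministic X T^[n]) :
    TopDeterministic X T := by
  intro Y _ _ S hS hSsurj ⟨π, hπ, hπsurj, hcomm⟩
  obtain ⟨m, rfl⟩ := Nat.exists_eq_add_of_le' hn
  have hsemi : Function.Semiconj π T S := fun x => (congrFun hcomm x).symm
  have hinj : Function.Injective S^[m + 1] :=
    hdet Y S^[m + 1] (hS.iterate _) (hSsurj.iterate _)
      ⟨π, hπ, hπsurj, funext fun x => (hsemi.iterate_right (m + 1) x).symm⟩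
  rw [Function.iterate_succ] at hinj
  exact hinj.of_comp
end

section
/- There exists a topological dynamical system (X,T) with T a homeomorphism of X such that (X,T) is pointwise rigid but (X,T^{-1}) is not pointwise rigid. -/
open Filter Topology

open Nat in
/-- The `j`-th sawtooth, of period `j!`, evaluated at an integer. -/
noncomputable def sawtooth (j : ℕ) (n : ℤ) : ℝ := ((n % (j ! : ℤ) : ℤ) : ℝ) / (j ! : ℝ)

/-- The supremum of all factorial sawtooths. It vanishes at `0` and equals `1` at every
negative integer. -/
noncomputable def sawtoothSup (n : ℤ) : ℝ := ⨆ j, sawtooth j n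

open Nat in
theorem sawtooth_nonneg (j : ℕ) (n : ℤ) : 0 ≤ sawtooth j n := by
  have h : 0 ≤ n % (j ! : ℤ) := Int.emod_nonneg _ (by exact_mod_cast j.factorial_ne_zero)
  have h' : (0 : ℝ) ≤ ((n % (j ! : ℤ) : ℤ) : ℝ) := by exact_mod_cast h
  unfold sawtooth
  positivity

open Nat in
theorem sawtooth_le_one (j : ℕ) (n : ℤ) : sawtooth j n ≤ 1 := by
  have hj : (0 : ℤ) < j ! := by exact_mod_cast j.factorial_pos
  have h : n % (j ! : ℤ) ≤ (j ! : ℤ) := (Int.emod_lt_of_pos _ hj).le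
  unfold sawtooth
  rw [div_le_one (by exact_mod_cast hj)]
  exact_mod_cast h

theorem sawtooth_le_sawtoothSup (j : ℕ) (n : ℤ) : sawtooth j n ≤ sawtoothSup n :=
  le_ciSup (f := fun j => sawtooth j n)
    ⟨1, by rintro _ ⟨i, rfl⟩; exact sawtooth_le_one i n⟩ j

theorem sawtoothSup_nonneg (n : ℤ) : 0 ≤ sawtoothSup n :=
  (sawtooth_nonneg 0 n).trans (sawtooth_le_sawtoothSup 0 n)

theorem sawtoothSup_le_one (n : ℤ) : sawtoothSup n ≤ 1 :=
  ciSup_le fun j => sawtooth_le_one j n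

theorem sawtoothSup_zero : sawtoothSup 0 = 0 := by
  simp [sawtoothSup, sawtooth]

open Nat in
theorem sawtoothSup_of_neg {n : ℤ} (hn : n < 0) : sawtoothSup n = 1 := by
  refine le_antisymm (sawtoothSup_le_one n) (le_of_forall_pos_sub_le fun ε hε => ?_)
  obtain ⟨j, hj⟩ := exists_nat_gt (max (-n : ℝ) ((-n : ℝ) / ε))
  have hjf : (j : ℝ) ≤ (j ! : ℝ) := by exact_mod_cast j.self_le_factorial
  have h1 : (-n : ℝ) < (j ! : ℝ) := ((le_max_left _ _).trans_lt hj).trans_le hjf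
  have h2 : (-n : ℝ) / ε < (j ! : ℝ) := ((le_max_right _ _).trans_lt hj).trans_le hjf
  have h1' : -n < (j ! : ℤ) := by exact_mod_cast h1
  have hpos : (0 : ℝ) < (j ! : ℝ) := by exact_mod_cast j.factorial_pos
  refine le_trans ?_ (sawtooth_le_sawtoothSup j n)
  have hmod : n % (j ! : ℤ) = n + (j ! : ℤ) := by
    rw [← Int.add_emod_right]
    exact Int.emod_eq_of_lt (by omega) (by omega)
  unfold sawtooth
  rw [hmod, le_div_iff₀ hpos]
  rw [div_lt_iff₀ hε] at h2
  push_cast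
  nlinarith

theorem abs_sawtoothSup_sub_le {m n : ℤ} {ε : ℝ}
    (h : ∀ j, |sawtooth j m - sawtooth j n| ≤ ε) : |sawtoothSup m - sawtoothSup n| ≤ ε := by
  have key : ∀ {a b : ℤ}, (∀ j, sawtooth j a ≤ sawtooth j b + ε) →
      sawtoothSup a ≤ sawtoothSup b + ε := fun {a b} hab =>
    ciSup_le fun j => (hab j).trans (by linarith [sawtooth_le_sawtoothSup j b])
  have h1 := key (a := m) (b := n) fun j => by linarith [(abs_le.1 (h j)).2]
  have h2 := key (a := n) (b := m) fun j => by linarith [(abs_le.1 (h j)).1]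
  rw [abs_le]
  constructor <;> linarith

open Nat in
/-- Translating by `(k + 1)!` nearly preserves the value at `n`, unless all values at points
near `n` are nearly `1`. -/
def AlmostPeriodicOrNearOne (z : ℤ → ℝ) : Prop :=
  ∀ (n : ℤ) (k : ℕ), |z (n + ((k + 1)! : ℕ)) - z n| ≤ 2 / ((k : ℝ) + 1) ∨
    ∀ d : ℤ, |d| ≤ (k ! : ℕ) → 1 - 2 / ((k : ℝ) + 1) ≤ z (n + d)

open Nat in
theorem almostPeriodicOrNearOne_sawtoothSup : AlmostPeriodicOrNearOne sawtoothSup := by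
  intro n k
  have hRpos : (0 : ℤ) < (k ! : ℕ) := by exact_mod_cast k.factorial_pos
  have hKR : (((k + 1)! : ℕ) : ℤ) = (k + 1) * (k ! : ℕ) := by
    rw [Nat.factorial_succ]; push_cast; ring
  have hKpos : (0 : ℤ) < ((k + 1)! : ℕ) := by exact_mod_cast (k + 1).factorial_pos
  have hRK : ((k ! : ℕ) : ℤ) ≤ ((k + 1)! : ℕ) := by
    exact_mod_cast Nat.factorial_le (Nat.le_succ k)
  have hk : (0 : ℝ) < (k : ℝ) + 1 := by positivity
  have hk2 : (0 : ℝ) < 2 / ((k : ℝ) + 1) := by positivity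
  have hQ : ∀ j, k + 1 < j → ((k : ℤ) + 2) * ((k + 1)! : ℕ) ≤ (j ! : ℕ) := fun j hj => by
    have := Nat.factorial_le (show k + 2 ≤ j from hj)
    rw [Nat.factorial_succ (k + 1)] at this
    exact_mod_cast this
  by_cases hwrap : ∃ j, k + 1 < j ∧ (j ! : ℤ) ≤ n % (j ! : ℤ) + ((k + 1)! : ℕ)
  · obtain ⟨j, hj, hle⟩ := hwrap
    by_cases hlast : (((k + 1)! : ℕ) : ℤ) - (k ! : ℕ) ≤ n % ((k + 1)! : ℕ)
    · left
      have hs : 1 - 2 / ((k : ℝ) + 1) ≤ sawtooth (k + 1) n := by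
        have hKpos' : (0 : ℝ) < ((k + 1)! : ℕ) := by exact_mod_cast hKpos
        have hlast' : (((k + 1)! : ℕ) : ℝ) - (k ! : ℕ) ≤ ((n % ((k + 1)! : ℕ) : ℤ) : ℝ) := by
          exact_mod_cast hlast
        have hKR' : (((k + 1)! : ℕ) : ℝ) = (k + 1) * (k ! : ℕ) := by exact_mod_cast hKR
        have hR' : (0 : ℝ) < (k ! : ℕ) := by exact_mod_cast hRpos
        unfold sawtooth
        rw [le_div_iff₀ hKpos']
        refine le_trans ?_ hlast'
        have : 2 / ((k : ℝ) + 1) * ((k + 1)! : ℕ) = 2 * (k ! : ℕ) := by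
          rw [hKR']; field_simp
        linarith
      have hs' : sawtooth (k + 1) (n + ((k + 1)! : ℕ)) = sawtooth (k + 1) n := by
        unfold sawtooth; rw [Int.add_emod_right]
      have h1 := sawtooth_le_sawtoothSup (k + 1) n
      have h2 := sawtooth_le_sawtoothSup (k + 1) (n + ((k + 1)! : ℕ))
      have h3 := sawtoothSup_le_one n
      have h4 := sawtoothSup_le_one (n + ((k + 1)! : ℕ))
      rw [abs_le]
      constructor <;> linarith
    · right
      intro d hd
      push Not at hlast
      obtain ⟨hd1, hd2⟩ := abs_le.1 hd
      refine le_trans ?_ (sawtooth_le_sawtoothSup j (n + d))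
      have hQj := hQ j hj
      have hQpos : (0 : ℤ) < (j ! : ℕ) := by exact_mod_cast j.factorial_pos
      have hdvd : (((k + 1)! : ℕ) : ℤ) ∣ (j ! : ℕ) := by
        exact_mod_cast Nat.factorial_dvd_factorial hj.le
      have hlt := Int.emod_lt_of_pos n hQpos
      have hupper : n % (j ! : ℕ) < (j ! : ℕ) - (k ! : ℕ) := by
        have hmm : n % (j ! : ℕ) % ((k + 1)! : ℕ) = n % ((k + 1)! : ℕ) :=
          Int.emod_emod_of_dvd n hdvd
        have hdm := Int.emod_add_mul_ediv (n % (j ! : ℕ)) ((k + 1)! : ℕ)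
        rw [hmm] at hdm
        obtain ⟨s, hs⟩ := hdvd
        set t := n % (j ! : ℕ) / ((k + 1)! : ℕ)
        have hts : t + 1 ≤ s := by
          by_contra! hcon
          have h0 := Int.emod_nonneg n hKpos.ne'
          nlinarith
        nlinarith
      have hmod : (n + d) % (j ! : ℕ) = n % (j ! : ℕ) + d := by
        rw [← Int.emod_add_emod]
        refine Int.emod_eq_of_lt ?_ (by omega)
        nlinarith
      have hKQ : (((k : ℝ) + 1)) * ((k + 1)! : ℕ) ≤ (j ! : ℕ) := by
        have : (((k : ℤ) + 1)) * ((k + 1)! : ℕ) ≤ (j ! : ℕ) := by nlinarith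
        exact_mod_cast this
      have hlow : ((j ! : ℕ) : ℝ) - 2 * ((k + 1)! : ℕ) ≤ ((n % (j ! : ℕ) + d : ℤ) : ℝ) := by
        have : ((j ! : ℕ) : ℤ) - 2 * ((k + 1)! : ℕ) ≤ n % (j ! : ℕ) + d := by omega
        exact_mod_cast this
      unfold sawtooth
      rw [hmod, le_div_iff₀ (by exact_mod_cast hQpos)]
      refine le_trans ?_ hlow
      have : 2 * (((k + 1)! : ℕ) : ℝ) ≤ 2 / ((k : ℝ) + 1) * (j ! : ℕ) := by
        rw [div_mul_eq_mul_div, le_div_iff₀ hk]; linarith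
      linarith
  · left
    push Not at hwrap
    refine abs_sawtoothSup_sub_le fun j => ?_
    rcases le_or_gt j (k + 1) with hj | hj
    · have hdvd : ((j ! : ℕ) : ℤ) ∣ ((k + 1)! : ℕ) := by
        exact_mod_cast Nat.factorial_dvd_factorial hj
      have : (n + ((k + 1)! : ℕ)) % ((j ! : ℕ) : ℤ) = n % (j ! : ℕ) := by
        rw [Int.add_emod, Int.emod_eq_zero_of_dvd hdvd, add_zero, Int.emod_emod]
      unfold sawtooth
      rw [this, sub_self, abs_zero]
      exact hk2.le
    · have hQpos : (0 : ℤ) < (j ! : ℕ) := by exact_mod_cast j.factorial_pos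
      have h0 := Int.emod_nonneg n hQpos.ne'
      have hmod : (n + ((k + 1)! : ℕ)) % ((j ! : ℕ) : ℤ) = n % (j ! : ℕ) + ((k + 1)! : ℕ) := by
        rw [← Int.emod_add_emod]
        exact Int.emod_eq_of_lt (by omega) (hwrap j hj)
      have hKQ : (((k : ℝ) + 1)) * ((k + 1)! : ℕ) ≤ (j ! : ℕ) := by
        have : (((k : ℤ) + 1)) * ((k + 1)! : ℕ) ≤ (j ! : ℕ) := by nlinarith [hQ j hj]
        exact_mod_cast this
      have hQ' : (0 : ℝ) < (j ! : ℕ) := by exact_mod_cast hQpos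
      unfold sawtooth
      rw [hmod, ← sub_div]
      push_cast
      rw [add_sub_cancel_left, abs_of_nonneg (by positivity), div_le_div_iff₀ hQ' hk]
      nlinarith

theorem AlmostPeriodicOrNearOne.comp_add {z : ℤ → ℝ} (hz : AlmostPeriodicOrNearOne z) (c : ℤ) :
    AlmostPeriodicOrNearOne fun n => z (n + c) := by
  intro n k
  simpa only [add_right_comm] using hz (n + c) k

open Nat in
theorem AlmostPeriodicOrNearOne.tendsto {z : ℤ → ℝ} (hz : AlmostPeriodicOrNearOne z)
    (hz1 : ∀ n, z n ≤ 1) (n : ℤ) :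
    Tendsto (fun k : ℕ => z (n + ((k + 1)! : ℕ))) atTop (𝓝 (z n)) := by
  have hlim : Tendsto (fun k : ℕ => 2 / ((k : ℝ) + 1)) atTop (𝓝 0) := by
    simpa [div_eq_mul_inv] using (tendsto_one_div_add_atTop_nhds_zero_nat (𝕜 := ℝ)).const_mul 2
  by_cases hev : ∀ᶠ k : ℕ in atTop, |z (n + ((k + 1)! : ℕ)) - z n| ≤ 2 / ((k : ℝ) + 1)
  · rw [tendsto_iff_norm_sub_tendsto_zero]
    exact squeeze_zero' (Eventually.of_forall fun _ => norm_nonneg _) hev hlim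
  · have hfreq : ∃ᶠ k : ℕ in atTop, ∀ d : ℤ, |d| ≤ (k ! : ℕ) →
        1 - 2 / ((k : ℝ) + 1) ≤ z (n + d) :=
      (not_eventually.1 hev).mono fun k hk => (hz n k).resolve_left hk
    have hone : ∀ m, z m = 1 := by
      refine fun m => le_antisymm (hz1 m) (le_of_forall_pos_sub_le fun ε hε => ?_)
      obtain ⟨k, hk, hkε, hkm⟩ := (hfreq.and_eventually ((hlim.eventually_le_const hε).and
        (eventually_ge_atTop (m - n).natAbs))).exists
      have hkf := k.self_le_factorial
      have := hk (m - n) (by rw [Int.abs_eq_natAbs]; omega)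
      rw [add_sub_cancel] at this
      linarith
    simp [hone]

/-- The space of `[0,1]`-valued two-sided sequences satisfying `AlmostPeriodicOrNearOne`. -/
abbrev RigidShift : Type :=
  {z : ℤ → unitInterval // AlmostPeriodicOrNearOne fun n => (z n : ℝ)}

instance instCompactSpaceRigidShift : CompactSpace RigidShift := by
  refine isCompact_iff_compactSpace.1 (IsClosed.isCompact ?_)
  have hset : {z : ℤ → unitInterval | AlmostPeriodicOrNearOne fun n => (z n : ℝ)} =
      ⋂ (n : ℤ) (k : ℕ), ({z | |(z (n + ((k + 1).factorial : ℕ)) : ℝ) - z n| ≤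
          2 / ((k : ℝ) + 1)} ∪
        ⋂ (d : ℤ) (_ : |d| ≤ (k.factorial : ℕ)), {z | 1 - 2 / ((k : ℝ) + 1) ≤ z (n + d)}) := by
    ext z
    simp [AlmostPeriodicOrNearOne]
  change IsClosed {z : ℤ → unitInterval | AlmostPeriodicOrNearOne fun n => (z n : ℝ)}
  rw [hset]
  refine isClosed_iInter fun n => isClosed_iInter fun k => IsClosed.union ?_ ?_
  · exact isClosed_le (by fun_prop) continuous_const
  · exact isClosed_iInter fun d => isClosed_iInter fun _ =>
      isClosed_le continuous_const (by fun_prop)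

/-- Translation by an integer on `RigidShift`. -/
def RigidShift.translate (c : ℤ) (z : RigidShift) : RigidShift :=
  ⟨fun n => z.1 (n + c), z.2.comp_add c⟩

theorem RigidShift.continuous_translate (c : ℤ) : Continuous (translate c) := by
  refine Continuous.subtype_mk (continuous_pi fun n => ?_) _
  exact (continuous_apply (n + c)).comp continuous_subtype_val

/-- The shift homeomorphism of `RigidShift`. -/
def RigidShift.shift : RigidShift ≃ₜ RigidShift where
  toFun := translate 1
  invFun := translate (-1)
  left_inv z := by ext n; simp [translate]
  right_inv z := by ext n; simp [translate]
  continuous_toFun := continuous_translate 1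
  continuous_invFun := continuous_translate (-1)

theorem RigidShift.iterate_translate (c : ℤ) (m : ℕ) (z : RigidShift) (n : ℤ) :
    ((translate c)^[m] z).1 n = z.1 (n + m * c) := by
  induction m generalizing n with
  | zero => simp
  | succ m ih =>
    rw [Function.iterate_succ_apply']
    change ((translate c)^[m] z).1 (n + c) = _
    rw [ih, show n + c + m * c = n + (m + 1 : ℕ) * c by push_cast; ring]

theorem RigidShift.pointwiseRigid_shift : PointwiseRigid shift := by
  refine ⟨fun k => (k + 1).factorial, ?_, fun z => ?_⟩
  · exact tendsto_atTop_mono (fun k => (Nat.le_succ k).trans (k + 1).self_le_factorial) tendsto_id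
  · rw [tendsto_subtype_rng, tendsto_pi_nhds]
    intro n
    rw [tendsto_subtype_rng]
    have h := z.2.tendsto (fun n => (z.1 n).2.2) n
    refine h.congr fun k => ?_
    have := iterate_translate 1 (k + 1).factorial z n
    rw [mul_one] at this
    exact congrArg Subtype.val this.symm

/-- The point of `RigidShift` given by `sawtoothSup`. -/
noncomputable def RigidShift.sawtoothPoint : RigidShift :=
  ⟨fun n => ⟨sawtoothSup n, sawtoothSup_nonneg n, sawtoothSup_le_one n⟩,
    almostPeriodicOrNearOne_sawtoothSup⟩

theorem RigidShift.not_pointwiseRigid_shift_symm : ¬ PointwiseRigid shift.symm := by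
  rintro ⟨m, hm, h⟩
  have h0 := h sawtoothPoint
  rw [tendsto_subtype_rng, tendsto_pi_nhds] at h0
  have h1 := tendsto_subtype_rng.1 (h0 0)
  have h2 : Tendsto (fun _ : ℕ => (1 : ℝ)) atTop (𝓝 (sawtoothSup 0)) := by
    refine h1.congr' ?_
    filter_upwards [hm.eventually_gt_atTop 0] with k hk
    have := iterate_translate (-1) (m k) sawtoothPoint 0
    refine (congrArg Subtype.val this).trans (sawtoothSup_of_neg ?_)
    omega
  rw [sawtoothSup_zero] at h2
  exact one_ne_zero (tendsto_nhds_unique tendsto_const_nhds h2)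

/-- there exists a topological dynamical system `(X,T)` with `T` a
homeomorphism such that `(X,T)` is pointwise rigid but `(X,T⁻¹)` is not. -/
theorem stmt15 :
    ∃ (S : TDSystem) (h : S.X ≃ₜ S.X), S.T = ⇑h ∧
      PointwiseRigid S.T ∧ ¬ PointwiseRigid ⇑h.symm := by
  have : SecondCountableTopology RigidShift :=
    TopologicalSpace.Subtype.secondCountableTopology
      {z : ℤ → unitInterval | AlmostPeriodicOrNearOne fun n => (z n : ℝ)}
  have : TopologicalSpace.MetrizableSpace RigidShift :=
    TopologicalSpace.metrizableSpace_of_t3_secondCountable RigidShift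
  exact ⟨@TDSystem.mk RigidShift (TopologicalSpace.metrizableSpaceMetric RigidShift)
    instCompactSpaceRigidShift RigidShift.shift RigidShift.shift.continuous
    RigidShift.shift.surjective, RigidShift.shift, rfl,
    RigidShift.pointwiseRigid_shift, RigidShift.not_pointwiseRigid_shift_symm⟩
end

section
/- There exists a topological dynamical system (X,T) that is topologically deterministic but for which not every point of X × X is forward recurrent for T×T (so forward recurrence of all points of X × X is sufficient but not necessary for topological determinism). -/
open Filter Topology

/-- A system that is the union of two pointwise rigid pieces (possibly along different
sequences), one of them closed and invariant, is topologically deterministic. -/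
theorem topDeterministic_of_union_rigid {X : Type} [MetricSpace X] [CompactSpace X] {T : X → X}
    {A B : Set X} (hB : IsClosed B) (hAB : A ∪ B = Set.univ)
    (hTB : Set.MapsTo T B B) {u v : ℕ → ℕ} (hu : ∀ k, 0 < u k) (hv : ∀ k, 0 < v k)
    (hrA : ∀ x ∈ A, Tendsto (fun k => T^[u k] x) atTop (𝓝 x))
    (hrB : ∀ x ∈ B, Tendsto (fun k => T^[v k] x) atTop (𝓝 x)) :
    TopDeterministic X T := by
  intro Y _ _ S _ _ ⟨π, hπ, hπs, hSπ⟩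
  have semi : Function.Semiconj π T S := fun x => (congrFun hSπ x).symm
  have iter : ∀ {x y}, S (π x) = S (π y) → ∀ n, 0 < n → π (T^[n] x) = π (T^[n] y) := by
    intro x y h n hn
    obtain ⟨m, rfl⟩ := Nat.exists_eq_succ_of_ne_zero hn.ne'
    rw [semi.iterate_right _ x, semi.iterate_right _ y, Function.iterate_succ_apply,
      Function.iterate_succ_apply, h]
  have same : ∀ {C : Set X} {w : ℕ → ℕ}, (∀ k, 0 < w k) →
      (∀ x ∈ C, Tendsto (fun k => T^[w k] x) atTop (𝓝 x)) →
      ∀ x ∈ C, ∀ y ∈ C, S (π x) = S (π y) → π x = π y := by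
    intro C w hw hr x hx y hy h
    refine tendsto_nhds_unique (((hπ.tendsto x).comp (hr x hx))) ?_
    refine ((hπ.tendsto y).comp (hr y hy)).congr fun k => ?_
    exact (iter h _ (hw k)).symm
  have cross : ∀ x ∈ A, ∀ y ∈ B, S (π x) = S (π y) → π x = π y := by
    intro x hx y hy h
    obtain ⟨y', hy', φ, hφ, hlim⟩ :=
      hB.isCompact.tendsto_subseq (x := fun k => T^[u k] y) fun k => hTB.iterate _ hy
    have hxy' : π x = π y' := by
      refine tendsto_nhds_unique
        ((hπ.tendsto x).comp ((hrA x hx).comp hφ.tendsto_atTop)) ?_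
      refine ((hπ.tendsto y').comp hlim).congr fun k => ?_
      exact (iter h _ (hu _)).symm
    rw [hxy'] at h ⊢
    exact same hv hrB y' hy' y hy h
  intro p q hpq
  obtain ⟨x, rfl⟩ := hπs p
  obtain ⟨y, rfl⟩ := hπs q
  have hx : x ∈ A ∪ B := hAB ▸ Set.mem_univ x
  have hy : y ∈ A ∪ B := hAB ▸ Set.mem_univ y
  rcases hx with hx | hx <;> rcases hy with hy | hy
  · exact same hu hrA x hx y hy hpq
  · exact cross x hx y hy hpq
  · exact (cross y hy x hx hpq.symm).symm
  · exact same hv hrB x hx y hy hpq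

/-- The `[0,1]`-valued functions on `ℤ` that change by at most `1/(i+1)` under translation
by `i!`, for every `i ∈ I`. -/
def slowFunctions (I : Set ℕ) : Set (ℤ → unitInterval) :=
  {x | ∀ i ∈ I, ∀ t : ℤ, |(x (t + (i.factorial : ℤ)) : ℝ) - x t| ≤ 1 / ((i : ℝ) + 1)}

theorem isClosed_slowFunctions (I : Set ℕ) : IsClosed (slowFunctions I) := by
  simp only [slowFunctions, Set.ofPred_forall]
  refine isClosed_iInter fun i => isClosed_iInter fun _ => isClosed_iInter fun t => ?_
  exact isClosed_le (by fun_prop) continuous_const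

/-- The shift on functions on `ℤ`. -/
def intShift (x : ℤ → unitInterval) : ℤ → unitInterval := fun t => x (t + 1)

theorem continuous_intShift : Continuous intShift := by
  unfold intShift
  fun_prop

theorem intShift_iterate_apply (n : ℕ) (x : ℤ → unitInterval) (t : ℤ) :
    intShift^[n] x t = x (t + n) := by
  induction n generalizing x with
  | zero => simp
  | succ n ih =>
    rw [Function.iterate_succ_apply, ih]
    simp only [intShift]
    push_cast
    ring_nf

theorem intShift_mem_slowFunctions {I : Set ℕ} {x : ℤ → unitInterval} :
    intShift x ∈ slowFunctions I ↔ x ∈ slowFunctions I := by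
  constructor
  · intro h i hi t
    have := h i hi (t - 1)
    simp only [intShift] at this
    rwa [show t - 1 + (i.factorial : ℤ) + 1 = t + i.factorial by ring, sub_add_cancel] at this
  · intro h i hi t
    have := h i hi (t + 1)
    simp only [intShift]
    rwa [show t + (i.factorial : ℤ) + 1 = t + 1 + i.factorial by ring]

theorem tendsto_intShift_iterate_factorial {I : Set ℕ} {u : ℕ → ℕ} (hu : Tendsto u atTop atTop)
    (huI : ∀ k, u k ∈ I) {x : ℤ → unitInterval} (hx : x ∈ slowFunctions I) :
    Tendsto (fun k => intShift^[(u k).factorial] x) atTop (𝓝 x) := by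
  refine tendsto_pi_nhds.2 fun t => tendsto_subtype_rng.2 ?_
  rw [tendsto_iff_dist_tendsto_zero]
  refine squeeze_zero (fun _ => dist_nonneg) (fun k => ?_)
    ((tendsto_one_div_add_atTop_nhds_zero_nat (𝕜 := ℝ)).comp hu)
  simpa [intShift_iterate_apply, Real.dist_eq] using hx (u k) (huI k) t

/-- `t` is an integral combination `∑ eᵢ i!` with `e` supported in `I` and
`∑ |eᵢ| / (i+1) ≤ r`. -/
def IsFactorialCombination (I : Set ℕ) (t : ℤ) (r : ℝ) : Prop :=
  ∃ e : ℕ → ℤ, (∀ i ∉ I, e i = 0) ∧ ∀ᶠ n in atTop,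
    ∑ i ∈ Finset.range n, e i * (i.factorial : ℤ) = t ∧
      ∑ i ∈ Finset.range n, |(e i : ℝ)| / ((i : ℝ) + 1) ≤ r

theorem IsFactorialCombination.nonneg {I : Set ℕ} {t : ℤ} {r : ℝ}
    (h : IsFactorialCombination I t r) : 0 ≤ r := by
  obtain ⟨e, -, he⟩ := h
  obtain ⟨n, -, hn⟩ := he.exists
  exact le_trans (Finset.sum_nonneg fun i _ => by positivity) hn

theorem isFactorialCombination_zero (I : Set ℕ) : IsFactorialCombination I 0 0 :=
  ⟨0, by simp, by simp⟩

theorem IsFactorialCombination.add_single {I : Set ℕ} {t : ℤ} {r : ℝ}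
    (h : IsFactorialCombination I t r) {i : ℕ} (hi : i ∈ I) {s : ℤ} (hs : |s| = 1) :
    IsFactorialCombination I (t + s * (i.factorial : ℤ)) (r + 1 / ((i : ℝ) + 1)) := by
  obtain ⟨e, heI, he⟩ := h
  have hs' : |(s : ℝ)| = 1 := by exact_mod_cast hs
  refine ⟨e + Pi.single i s, fun j hj => ?_, ?_⟩
  · have : j ≠ i := fun h => hj (h ▸ hi)
    simp [heI j hj, this]
  filter_upwards [he, eventually_gt_atTop i] with n ⟨h1, h2⟩ hn
  have hmem : i ∈ Finset.range n := Finset.mem_range.2 hn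
  constructor
  · simp only [Pi.add_apply, add_mul, Finset.sum_add_distrib, h1]
    congr 1
    rw [Finset.sum_eq_single_of_mem i hmem]
    · simp
    · intro j _ hj
      simp [hj]
  · have key : ∑ j ∈ Finset.range n, |((Pi.single i s : ℕ → ℤ) j : ℝ)| / ((j : ℝ) + 1) =
        1 / ((i : ℝ) + 1) := by
      rw [Finset.sum_eq_single_of_mem i hmem]
      · simp [hs']
      · intro j _ hj
        simp [hj]
    rw [← key]
    refine le_trans ?_ (add_le_add_left h2 _)
    rw [← Finset.sum_add_distrib]
    refine Finset.sum_le_sum fun j _ => ?_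
    rw [← add_div]
    gcongr
    push_cast [Pi.add_apply]
    exact abs_add_le _ _

/-- The integer expansion in factorials with digits `|gᵢ| ≤ i` is unique. -/
theorem eq_zero_of_sum_mul_factorial_eq_zero {g : ℕ → ℤ} (n : ℕ) (hg : ∀ i < n, |g i| ≤ i)
    (h : ∑ i ∈ Finset.range n, g i * (i.factorial : ℤ) = 0) : ∀ i < n, g i = 0 := by
  have bound : ∀ m ≤ n, |∑ i ∈ Finset.range m, g i * (i.factorial : ℤ)| < m.factorial := by
    intro m hm
    induction m with
    | zero => simp
    | succ m ih =>
      rw [Finset.sum_range_succ]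
      refine (abs_add_le _ _).trans_lt ?_
      have h1 := ih (by omega)
      have h2 := hg m (by omega)
      rw [abs_mul, Nat.abs_cast, Nat.factorial_succ]
      push_cast
      have h3 := mul_le_mul_of_nonneg_right h2 (Int.natCast_nonneg m.factorial)
      linarith
  induction n with
  | zero => simp
  | succ n ih =>
    rw [Finset.sum_range_succ] at h
    have hn : g n = 0 := by
      by_contra hne
      have h1 := bound n (by omega)
      rw [eq_neg_of_add_eq_zero_left h, abs_neg, abs_mul, Nat.abs_cast] at h1
      have h2 := Int.one_le_abs hne
      have h3 := mul_le_mul_of_nonneg_right h2 (Int.natCast_nonneg n.factorial)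
      linarith
    rw [hn, zero_mul, add_zero] at h
    intro i hi
    rcases Nat.lt_succ_iff_lt_or_eq.1 hi with hi | rfl
    · exact ih (fun i hi => hg i (by omega)) h (fun m hm => bound m (by omega)) i hi
    · exact hn

theorem IsFactorialCombination.eq_zero {I : Set ℕ} {t : ℤ} {r s : ℝ}
    (h : IsFactorialCombination I t r) (h' : IsFactorialCombination Iᶜ t s)
    (hr : r < 1) (hs : s < 1) : t = 0 := by
  obtain ⟨e, heI, he⟩ := h
  obtain ⟨f, hfI, hf⟩ := h'
  obtain ⟨n, ⟨he1, he2⟩, hf1, hf2⟩ := (he.and hf).exists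
  have digit : ∀ (c : ℕ → ℤ) (q : ℝ), q < 1 →
      ∑ i ∈ Finset.range n, |(c i : ℝ)| / ((i : ℝ) + 1) ≤ q → ∀ i < n, |c i| ≤ i := by
    intro c q hq hc i hi
    have h1 : |(c i : ℝ)| / ((i : ℝ) + 1) ≤ _ :=
      Finset.single_le_sum (f := fun i : ℕ => |(c i : ℝ)| / ((i : ℝ) + 1))
        (fun j _ => by positivity) (Finset.mem_range.2 hi)
    have h2 := (h1.trans hc).trans_lt hq
    rw [div_lt_one (by positivity)] at h2
    have h3 : |c i| < (i : ℤ) + 1 := by exact_mod_cast h2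
    omega
  have hg : ∀ i < n, e i - f i = 0 := by
    refine eq_zero_of_sum_mul_factorial_eq_zero (g := fun i => e i - f i) n (fun i hi => ?_) ?_
    · by_cases hiI : i ∈ I
      · simpa [hfI i (by simpa using hiI)] using digit e r hr he2 i hi
      · simpa [heI i hiI] using digit f s hs hf2 i hi
    · simp [sub_mul, Finset.sum_sub_distrib, he1, hf1]
  rw [← he1]
  refine Finset.sum_eq_zero fun i hi => ?_
  have h0 := hg i (Finset.mem_range.1 hi)
  by_cases hiI : i ∈ I
  · rw [hfI i (by simpa using hiI), sub_zero] at h0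
    simp [h0]
  · simp [heI i hiI]

/-- The translation-invariant norm on `ℤ` generated by giving `i!` the length `1/(i+1)` for
`i ∈ I`, truncated at `1`. -/
noncomputable def factorialNorm (I : Set ℕ) (t : ℤ) : ℝ :=
  sInf (insert 1 {r | IsFactorialCombination I t r})

theorem zero_mem_lowerBounds_combination (I : Set ℕ) (t : ℤ) :
    0 ∈ lowerBounds (insert 1 {r | IsFactorialCombination I t r}) := by
  rintro r (rfl | hr)
  · exact zero_le_one
  · exact hr.nonneg

theorem factorialNorm_mem (I : Set ℕ) (t : ℤ) : factorialNorm I t ∈ unitInterval :=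
  ⟨le_csInf (Set.insert_nonempty _ _) (zero_mem_lowerBounds_combination I t),
    csInf_le ⟨0, zero_mem_lowerBounds_combination I t⟩ (Set.mem_insert _ _)⟩

theorem factorialNorm_zero (I : Set ℕ) : factorialNorm I 0 = 0 :=
  le_antisymm (csInf_le ⟨0, zero_mem_lowerBounds_combination I 0⟩
    (Set.mem_insert_of_mem _ (isFactorialCombination_zero I))) (factorialNorm_mem I 0).1

theorem exists_combination_of_factorialNorm_lt_one {I : Set ℕ} {t : ℤ}
    (h : factorialNorm I t < 1) : ∃ r < 1, IsFactorialCombination I t r := by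
  obtain ⟨r, hr | hr, hr1⟩ := exists_lt_of_csInf_lt (Set.insert_nonempty _ _) h
  · exact absurd hr hr1.ne
  · exact ⟨r, hr1, hr⟩

theorem factorialNorm_add_le {I : Set ℕ} {i : ℕ} (hi : i ∈ I) {s : ℤ} (hs : |s| = 1) (t : ℤ) :
    factorialNorm I (t + s * (i.factorial : ℤ)) ≤ factorialNorm I t + 1 / ((i : ℝ) + 1) := by
  rw [← sub_le_iff_le_add]
  refine le_csInf (Set.insert_nonempty _ _) ?_
  rintro r (rfl | hr)
  · have h1 := (factorialNorm_mem I (t + s * (i.factorial : ℤ))).2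
    have h2 : 0 ≤ 1 / ((i : ℝ) + 1) := by positivity
    linarith
  · rw [sub_le_iff_le_add]
    exact csInf_le ⟨0, zero_mem_lowerBounds_combination _ _⟩
      (Set.mem_insert_of_mem _ (hr.add_single hi hs))

/-- `factorialNorm I` as a function into the unit interval. -/
noncomputable def factorialNormFunction (I : Set ℕ) (t : ℤ) : unitInterval :=
  ⟨factorialNorm I t, factorialNorm_mem I t⟩

theorem factorialNormFunction_mem_slowFunctions (I : Set ℕ) :
    factorialNormFunction I ∈ slowFunctions I := by
  intro i hi t
  have h1 := factorialNorm_add_le hi (s := 1) (by simp) t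
  have h2 := factorialNorm_add_le hi (s := -1) (by simp) (t + (i.factorial : ℤ))
  rw [one_mul] at h1
  rw [show t + (i.factorial : ℤ) + -1 * (i.factorial : ℤ) = t by ring] at h2
  rw [abs_le]
  simp only [factorialNormFunction]
  constructor <;> linarith

/-- Functions that are slow either for `I` or for its complement. -/
abbrev SlowUnion (I : Set ℕ) : Type := ↥(slowFunctions I ∪ slowFunctions Iᶜ)

instance (I : Set ℕ) : CompactSpace (SlowUnion I) :=
  isCompact_iff_compactSpace.1
    ((isClosed_slowFunctions I).union (isClosed_slowFunctions Iᶜ)).isCompact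

noncomputable instance (I : Set ℕ) : MetricSpace (SlowUnion I) :=
  TopologicalSpace.metrizableSpaceMetric _

/-- The shift on `SlowUnion I`. -/
def slowShift (I : Set ℕ) (x : SlowUnion I) : SlowUnion I :=
  ⟨intShift x.1, x.2.imp intShift_mem_slowFunctions.2 intShift_mem_slowFunctions.2⟩

theorem continuous_slowShift (I : Set ℕ) : Continuous (slowShift I) :=
  (continuous_intShift.comp continuous_subtype_val).subtype_mk _

theorem surjective_slowShift (I : Set ℕ) : Function.Surjective (slowShift I) := by
  intro x
  have h : intShift (fun t => x.1 (t - 1)) = x.1 := by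
    funext t
    simp [intShift]
  refine ⟨⟨fun t => x.1 (t - 1), ?_⟩, Subtype.ext h⟩
  have hx := x.2
  rw [← h] at hx
  exact hx.imp intShift_mem_slowFunctions.1 intShift_mem_slowFunctions.1

theorem coe_slowShift_iterate (I : Set ℕ) (n : ℕ) (x : SlowUnion I) :
    ((slowShift I)^[n] x : ℤ → unitInterval) = intShift^[n] x.1 :=
  Function.Semiconj.iterate_right (f := Subtype.val) (fun _ => rfl) n x

theorem topDeterministic_slowShift {I : Set ℕ} {u v : ℕ → ℕ} (hu : Tendsto u atTop atTop)
    (hv : Tendsto v atTop atTop) (huI : ∀ k, u k ∈ I) (hvI : ∀ k, v k ∈ Iᶜ) :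
    TopDeterministic (SlowUnion I) (slowShift I) := by
  refine topDeterministic_of_union_rigid
    (A := Subtype.val ⁻¹' slowFunctions I) (B := Subtype.val ⁻¹' slowFunctions Iᶜ)
    (u := fun k => (u k).factorial) (v := fun k => (v k).factorial)
    ((isClosed_slowFunctions Iᶜ).preimage continuous_subtype_val)
    (Set.eq_univ_of_forall fun x => x.2)
    (fun _ hx => intShift_mem_slowFunctions.2 hx)
    (fun _ => Nat.factorial_pos _) (fun _ => Nat.factorial_pos _) ?_ ?_
  · intro x hx
    refine tendsto_subtype_rng.2 ?_
    simp only [coe_slowShift_iterate]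
    exact tendsto_intShift_iterate_factorial hu huI hx
  · intro x hx
    refine tendsto_subtype_rng.2 ?_
    simp only [coe_slowShift_iterate]
    exact tendsto_intShift_iterate_factorial hv hvI hx

theorem not_forwardRecurrent_slowShift (I : Set ℕ) :
    ¬ ForwardRecurrent (Prod.map (slowShift I) (slowShift I))
      (⟨factorialNormFunction I, Or.inl (factorialNormFunction_mem_slowFunctions I)⟩,
        ⟨factorialNormFunction Iᶜ, Or.inr (factorialNormFunction_mem_slowFunctions Iᶜ)⟩) := by
  rintro ⟨n, hn, hlim⟩
  simp only [Prod.map_iterate, Prod.map_apply] at hlim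
  have eventually_lt : ∀ (J : Set ℕ) (hJ : factorialNormFunction J ∈ _),
      Tendsto (fun k => (slowShift I)^[n k] ⟨factorialNormFunction J, hJ⟩) atTop
        (𝓝 ⟨factorialNormFunction J, hJ⟩) → ∀ᶠ k in atTop, factorialNorm J (n k) < 1 := by
    intro J hJ h
    have h0 := (tendsto_pi_nhds.1 (tendsto_subtype_rng.1 h)) 0
    have h1 := tendsto_subtype_rng.1 h0
    simp only [coe_slowShift_iterate, intShift_iterate_apply, zero_add,
      factorialNormFunction, factorialNorm_zero] at h1
    exact h1.eventually_lt_const zero_lt_one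
  have hA := eventually_lt I _ ((continuous_fst.tendsto _).comp hlim)
  have hB := eventually_lt Iᶜ _ ((continuous_snd.tendsto _).comp hlim)
  obtain ⟨k, ⟨hk1, hk2⟩, hk⟩ := ((hA.and hB).and (hn.eventually_gt_atTop 0)).exists
  obtain ⟨r, hr, hre⟩ := exists_combination_of_factorialNorm_lt_one hk1
  obtain ⟨s, hs, hse⟩ := exists_combination_of_factorialNorm_lt_one hk2
  have := hre.eq_zero hse hr hs
  omega

/-- there exists a topologically deterministic system `(X,T)` for
which not every point of `X × X` is forward recurrent for `T×T`. -/
theorem stmt16 :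
    ∃ S : TDSystem,
      TopDeterministic S.X S.T ∧
      ¬ ∀ p : S.X × S.X, ForwardRecurrent (Prod.map S.T S.T) p := by
  refine ⟨⟨SlowUnion {i | Even i}, slowShift _, continuous_slowShift _, surjective_slowShift _⟩,
    ?_, fun h => not_forwardRecurrent_slowShift {i | Even i} (h _)⟩
  refine topDeterministic_slowShift (u := fun k => 2 * k) (v := fun k => 2 * k + 1)
    ?_ ?_ (fun k => even_two_mul k) (fun k => ?_)
  · exact tendsto_atTop_mono (fun k => by dsimp; omega) tendsto_id
  · exact tendsto_atTop_mono (fun k => by dsimp; omega) tendsto_id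
  · simp
end
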